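/- arXiv:2508.00351 — 3 statements merged into one kernel-verified Lean document; each statement's English description precedes it below -/
import Mathlib

section
/- (Explicit Pólya–Vinogradov, odd case) Let d ≥ 3 be a positive integer and let χ be an odd primitive Dirichlet character modulo d (i.e., χ(−1) = −1). Then for all positive integers n ≤ m, |∑_{k=n}^{m} χ(k)| ≤ d^{1/2} · ( (1/(2π)) ln d + (1/π) ln ln d + 1 ). -/
namespace PV

lemma gauss_norm {d : ℕ} [NeZero d] (χ : DirichletCharacter ℂ d) (h : χ.IsPrimitive) :
    ‖gaussSum χ (ZMod.stdAddChar : AddChar (ZMod d) ℂ)‖ = Real.sqrt d := by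
  set τ := gaussSum χ (ZMod.stdAddChar : AddChar (ZMod d) ℂ) with hτ
  have h1 := congrFun (ZMod.dft_dft (fun x => χ x)) (-1)
  rw [ZMod.dft_apply] at h1
  have h2 : ∀ k : ZMod d, ZMod.dft (fun x => χ x) k = χ⁻¹ (-k) * τ :=
    fun k => h.fourierTransform_eq_inv_mul_gaussSum k
  simp only [h2, smul_eq_mul, neg_neg, map_one, mul_one] at h1
  have h3 : star τ = ∑ k : ZMod d, ZMod.stdAddChar k * χ⁻¹ (-k) := by
    rw [hτ, star_gaussSum_eq, gaussSum, ← Equiv.sum_comp (Equiv.neg _)]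
    refine Finset.sum_congr rfl fun k _ => ?_
    simp [AddChar.inv_apply, mul_comm]
  have h4 : star τ * τ = d := by
    rw [h3, Finset.sum_mul, ← h1]
    refine Finset.sum_congr rfl fun k _ => ?_
    ring_nf
  have h5 : ‖τ‖ ^ 2 = d := by
    have := congrArg norm h4
    rw [norm_mul, norm_star] at this
    simpa [sq] using this
  rw [← h5, Real.sqrt_sq (norm_nonneg _)]

lemma arg_bound (v : ℂ) (hv : ‖v‖ ≤ 1) : |Complex.arg (1 - v)| ≤ Real.pi / 2 * ‖v‖ := by
  have hre : 0 ≤ (1 - v).re := by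
    have := (Complex.abs_re_le_norm v).trans hv
    simp; linarith [le_abs_self v.re]
  rw [Complex.arg_of_re_nonneg hre]
  have key : |(1 - v).im / ‖1 - v‖| ≤ ‖v‖ := by
    rw [abs_div, abs_norm]
    refine div_le_of_le_mul₀ (norm_nonneg _) (norm_nonneg _) ?_
    rw [← norm_mul]
    refine abs_le_of_sq_le_sq ?_ (norm_nonneg _)
    rw [← Complex.normSq_eq_norm_sq, map_mul, Complex.normSq_apply, Complex.normSq_apply]
    simp only [Complex.sub_im, Complex.sub_re, Complex.one_im, Complex.one_re]
    nlinarith [sq_nonneg (v.re * v.re + v.im * v.im - v.re)]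
  set t := (1 - v).im / ‖1 - v‖
  have ht := abs_le.1 key
  have hs : ∀ s : ℝ, 0 ≤ s → s ≤ 1 → Real.arcsin s ≤ Real.pi / 2 * s := by
    intro s h0 h1
    have := Real.mul_le_sin (Real.arcsin_nonneg.2 h0) (Real.arcsin_le_pi_div_two s)
    rw [Real.sin_arcsin (by linarith) h1] at this
    have hp := Real.pi_pos
    have : Real.arcsin s = Real.pi / 2 * (2 / Real.pi * Real.arcsin s) := by field_simp
    rw [this]; gcongr
  have hpi := Real.pi_pos
  have h1 := hs ‖v‖ (norm_nonneg _) hv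
  rw [abs_le]
  constructor
  · have := Real.monotone_arcsin ht.1
    rw [Real.arcsin_neg] at this; linarith
  · exact (Real.monotone_arcsin ht.2).trans h1

lemma poly_bound (r c : ℝ) (h0 : 0 < r) (h1 : r < 1) (hc : -1 ≤ c) (hc' : c ≤ 1) :
    (1 - 2 * r * c + r ^ 2) ^ 2 ≤ 4 * (1 - 2 * r ^ 2 * c + r ^ 4) := by
  have a : (1 - c) * (1 + r) ^ 4 + (1 + c) * (1 - r) ^ 4 ≤
      (1 - c) * (4 * (1 + r^2) ^ 2) + (1 + c) * (4 * (1 - r ^ 2) ^ 2) := by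
    have e1 : (1 + r) ^ 4 ≤ 4 * (1 + r^2) ^ 2 := by
      have : (1 + r) ^ 2 ≤ 2 * (1 + r ^ 2) := by nlinarith [sq_nonneg (1 - r)]
      nlinarith [sq_nonneg (1 + r)]
    have e2 : (1 - r) ^ 4 ≤ 4 * (1 - r^2) ^ 2 := by
      have : (1 - r) ^ 4 = (1 - r) ^ 2 * (1 - r) ^ 2 := by ring
      have : 4 * (1 - r^2) ^ 2 = (1 - r) ^ 2 * (4 * (1 + r) ^ 2) := by ring
      have : (1 - r) ^ 2 ≤ 4 * (1 + r) ^ 2 := by nlinarith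
      nlinarith [sq_nonneg (1 - r)]
    have := sub_nonneg.2 hc'
    have : 0 ≤ 1 + c := by linarith
    gcongr
  have b : 0 ≤ r ^ 2 * ((1 - c) * (1 + c)) :=
    mul_nonneg (sq_nonneg _) (mul_nonneg (by linarith) (by linarith))
  nlinarith

lemma hs_congr {E : Type*} [AddCommMonoid E] [TopologicalSpace E] {f g : ℕ → E} {a : E}
    (h : ∀ m, f m = g m) (hf : HasSum f a) : HasSum g a := (funext h : f = g) ▸ hf

lemma uu_re (s φ : ℝ) : (1 - (s : ℂ) * Complex.exp (φ * Complex.I)).re = 1 - s * Real.cos φ := by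
  simp [Complex.exp_ofReal_mul_I_re]

lemma uu_im (s φ : ℝ) : (1 - (s : ℂ) * Complex.exp (φ * Complex.I)).im = - (s * Real.sin φ) := by
  simp [Complex.exp_ofReal_mul_I_im]

lemma uu_normSq (s φ : ℝ) : Complex.normSq (1 - (s : ℂ) * Complex.exp (φ * Complex.I)) =
    1 - 2 * s * Real.cos φ + s ^ 2 := by
  rw [Complex.normSq_apply, uu_re, uu_im]
  linear_combination s ^ 2 * Real.sin_sq_add_cos_sq φ

lemma arg_one_sub (φ : ℝ) (h0 : 0 < φ) (h1 : φ < 2 * Real.pi) :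
    Complex.arg (1 - Complex.exp (φ * Complex.I)) = φ / 2 - Real.pi / 2 := by
  have hs : 0 < 2 * Real.sin (φ / 2) := by
    have := Real.sin_pos_of_pos_of_lt_pi (x := φ / 2) (by linarith) (by linarith)
    linarith
  have := Complex.arg_mul_cos_add_sin_mul_I hs (θ := φ / 2 - Real.pi / 2)
    ⟨by linarith, by linarith [Real.pi_pos]⟩
  rw [← this]
  congr 1
  rw [← Complex.ofReal_cos, ← Complex.ofReal_sin, Real.cos_sub_pi_div_two, Real.sin_sub_pi_div_two]
  have e1 : Real.cos φ = 1 - 2 * Real.sin (φ / 2) ^ 2 := by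
    have := Real.cos_two_mul' (φ / 2)
    have h2 := Real.sin_sq_add_cos_sq (φ / 2)
    rw [mul_div_cancel₀ _ two_ne_zero] at this
    linarith
  have e2 : Real.sin φ = 2 * Real.sin (φ / 2) * Real.cos (φ / 2) := by
    have := Real.sin_two_mul (φ / 2)
    rwa [mul_div_cancel₀ _ two_ne_zero] at this
  have a := uu_re 1 φ
  have b := uu_im 1 φ
  simp only [Complex.ofReal_one, one_mul] at a b
  apply Complex.ext
  · rw [a, e1, Complex.re_ofReal_mul, Complex.add_re, Complex.mul_I_re, Complex.ofReal_im,
      Complex.ofReal_re]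
    ring
  · rw [b, e2, Complex.im_ofReal_mul, Complex.add_im, Complex.mul_I_im, Complex.ofReal_im,
      Complex.ofReal_re]
    ring

lemma saw_bound (r φ : ℝ) (hr0 : 0 < r) (hr1 : r < 1) (h0 : 0 < φ) (h1 : φ < 2 * Real.pi) :
    |(-2 * Complex.log (1 - r * Complex.exp (φ * Complex.I)) +
        Complex.log (1 - (r ^ 2 : ℝ) * Complex.exp (φ * Complex.I))).im - (Real.pi / 2 - φ / 2)| ≤
      Real.pi / 2 * ((1 - r) ^ 2 / Complex.normSq (1 - r * Complex.exp (φ * Complex.I))) := by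
  have hpi := Real.pi_pos
  have hcos : Real.cos φ < 1 := by
    refine lt_of_le_of_ne (Real.cos_le_one _) fun h => ?_
    have := (Real.cos_eq_one_iff_of_lt_of_lt (by linarith) h1).1 h
    linarith
  have hcos' := Real.neg_one_le_cos φ
  have hre : ∀ s : ℝ, 0 < s → s ≤ 1 → 0 < (1 - (s : ℂ) * Complex.exp (φ * Complex.I)).re := by
    intro s hs0 hs1
    rw [uu_re]
    nlinarith
  have hr20 : 0 < r ^ 2 := by positivity
  have hr21 : r ^ 2 ≤ 1 := by nlinarith
  have hne : ∀ s : ℝ, 0 < s → s ≤ 1 → (1 - (s : ℂ) * Complex.exp (φ * Complex.I)) ≠ 0 := by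
    intro s hs0 hs1 h
    have := hre s hs0 hs1
    rw [h] at this; simp at this
  have hab : ∀ s : ℝ, 0 < s → s ≤ 1 →
      |Complex.arg (1 - (s : ℂ) * Complex.exp (φ * Complex.I))| < Real.pi / 2 := by
    intro s hs0 hs1
    exact Complex.abs_arg_lt_pi_div_two_iff.2 (Or.inl (hre s hs0 hs1))
  set u := Complex.exp (φ * Complex.I) with hu
  have ha1 := abs_lt.1 (hab 1 one_pos le_rfl)
  have har := abs_lt.1 (hab r hr0 hr1.le)
  have har2 := abs_lt.1 (hab (r^2) hr20 hr21)
  have hn1 := hne 1 one_pos le_rfl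
  have hnr := hne r hr0 hr1.le
  have hnr2 := hne (r^2) hr20 hr21
  have hsaw := arg_one_sub φ h0 h1
  rw [← hu] at hsaw
  simp only [Complex.ofReal_one, one_mul] at ha1 hn1
  set L := Complex.log (1 - (r ^ 2 : ℝ) * u) + Complex.log (1 - u) - 2 * Complex.log (1 - r * u)
    with hL
  have hLim : L.im = Complex.arg (1 - (r ^ 2 : ℝ) * u) + Complex.arg (1 - u)
      - 2 * Complex.arg (1 - r * u) := by
    simp [hL, Complex.log_im]
  have hrange : -Real.pi < L.im ∧ L.im < Real.pi := by
    rw [hLim]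
    rcases lt_or_ge 0 (Real.sin φ) with hs | hs
    · have neg : ∀ s : ℝ, 0 < s → Complex.arg (1 - (s : ℂ) * u) < 0 := by
        intro s hs0
        rw [Complex.arg_neg_iff, hu, uu_im]
        have := mul_pos hs0 hs
        linarith
      have b1 := neg 1 one_pos
      have br := neg r hr0
      have br2 := neg _ hr20
      simp only [Complex.ofReal_one, one_mul] at b1
      constructor <;> linarith
    · have pos : ∀ s : ℝ, 0 < s → 0 ≤ Complex.arg (1 - (s : ℂ) * u) := by
        intro s hs0
        rw [Complex.arg_nonneg_iff, hu, uu_im]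
        nlinarith
      have b1 := pos 1 one_pos
      have br := pos r hr0
      have br2 := pos _ hr20
      simp only [Complex.ofReal_one, one_mul] at b1
      constructor <;> linarith
  set v := u * (1 - r) ^ 2 / (1 - r * u) ^ 2 with hv
  have hexp : Complex.exp L = 1 - v := by
    rw [hL, Complex.exp_sub, Complex.exp_add, Complex.exp_log hnr2, Complex.exp_log hn1,
      two_mul, Complex.exp_add, Complex.exp_log hnr, hv]
    have hsq : (1 - r * u) * (1 - r * u) ≠ 0 := mul_ne_zero hnr hnr
    rw [sq (1 - r * u), eq_sub_iff_add_eq, ← add_div, div_eq_one_iff_eq hsq]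
    push_cast
    ring
  have hlog : Complex.log (1 - v) = L := by
    rw [← hexp, Complex.log_exp hrange.1 hrange.2.le]
  have hunorm : ‖u‖ = 1 := by rw [hu, Complex.norm_exp_ofReal_mul_I]
  have hvn : ‖v‖ = (1 - r) ^ 2 / Complex.normSq (1 - r * u) := by
    rw [hv, norm_div, norm_mul, hunorm, norm_pow, norm_pow, Complex.normSq_eq_norm_sq, one_mul]
    congr 2
    rw [← Complex.ofReal_one, ← Complex.ofReal_sub, Complex.norm_real, Real.norm_of_nonneg]
    linarith
  have hvle : ‖v‖ ≤ 1 := by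
    rw [hvn]
    refine div_le_one_of_le₀ ?_ (Complex.normSq_nonneg _)
    rw [hu, uu_normSq]
    nlinarith
  have := arg_bound v hvle
  rw [← hvn]
  refine le_trans (le_of_eq ?_) this
  congr 1
  rw [← Complex.log_im, hlog, hLim, hsaw]
  simp only [Complex.add_im, Complex.log_im, neg_mul, Complex.neg_im]
  simp [Complex.log_im]
  ring

/-- Sample angles. -/
noncomputable def ph (d j : ℕ) : ℝ := 2 * Real.pi * ((j : ℝ) + 1 / 2) / d

lemma sum_inv (d : ℕ) (hd : 0 < d) (r : ℝ) (hr0 : 0 < r) (hr1 : r < 1) :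
    ∑ j ∈ Finset.range d, (1 - r ^ 2) / Complex.normSq (1 - r * Complex.exp (ph d j * Complex.I))
      ≤ (d : ℝ) := by
  have hd0 : (d : ℂ) ≠ 0 := by exact_mod_cast hd.ne'
  set u : ℕ → ℂ := fun j => Complex.exp (ph d j * Complex.I) with hu
  have hun : ∀ j, ‖u j‖ = 1 := fun j => Complex.norm_exp_ofReal_mul_I _
  have hud : ∀ j, (u j) ^ d = -1 := by
    intro j
    simp only [hu, ph]
    rw [← Complex.exp_nat_mul]
    have : (d : ℂ) * (((2 * Real.pi * ((j : ℝ) + 1 / 2) / d : ℝ) : ℂ) * Complex.I) =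
        Real.pi * Complex.I + j * (2 * Real.pi * Complex.I) := by
      push_cast; field_simp; ring
    rw [this, Complex.exp_add, Complex.exp_nat_mul_two_pi_mul_I, mul_one, Complex.exp_pi_mul_I]
  have husum : ∀ i, 0 < i → i < d → ∑ j ∈ Finset.range d, (u j) ^ i = 0 := by
    intro i hi0 hid
    have hζ := Complex.isPrimitiveRoot_exp d hd.ne'
    set ζ := Complex.exp (2 * Real.pi * Complex.I / d)
    have e : ∀ j, (u j) ^ i = Complex.exp (Real.pi * Complex.I / d) ^ i * (ζ ^ i) ^ j := by
      intro j
      simp only [hu, ph, ζ]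
      rw [← Complex.exp_nat_mul, ← Complex.exp_nat_mul, ← Complex.exp_nat_mul,
        ← Complex.exp_nat_mul, ← Complex.exp_add]
      congr 1
      push_cast; field_simp; ring
    simp_rw [e]
    rw [← Finset.mul_sum]
    have hne : ζ ^ i ≠ 1 := hζ.pow_ne_one_of_pos_of_lt hi0.ne' hid
    rw [geom_sum_eq hne, ← pow_mul, mul_comm i d, pow_mul, hζ.pow_eq_one]
    simp
  have hrd : (0 : ℝ) < r ^ d := by positivity
  have hrdc : (1 + (r : ℂ) ^ d) ≠ 0 := by
    have : (1 + r ^ d : ℝ) ≠ 0 := by positivity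
    exact_mod_cast this
  have hz : ∀ j, (1 - r * u j) ≠ 0 := by
    intro j h
    have : ‖(r : ℂ) * u j‖ = 1 := by rw [← sub_eq_zero.1 h]; simp
    rw [norm_mul, hun, Complex.norm_real, Real.norm_of_nonneg hr0.le] at this
    linarith
  have hinv : ∀ j, (1 - r * u j)⁻¹ =
      (1 + (r : ℂ) ^ d)⁻¹ * ∑ i ∈ Finset.range d, (r : ℂ) ^ i * (u j) ^ i := by
    intro j
    have := mul_neg_geom_sum ((r : ℂ) * u j) d
    rw [mul_pow, hud] at this
    have h2 : (1 + (r : ℂ) ^ d) = (1 - r * u j) * ∑ i ∈ Finset.range d, ((r : ℂ) * u j) ^ i := by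
      rw [this]; ring
    simp_rw [← mul_pow]
    have h3 := hz j
    field_simp
    rw [h2]
  have hsum : ∑ j ∈ Finset.range d, (1 - r * u j)⁻¹ = d / (1 + (r : ℂ) ^ d) := by
    simp_rw [hinv]
    rw [← Finset.mul_sum, Finset.sum_comm]
    simp_rw [← Finset.mul_sum]
    rw [Finset.sum_eq_single_of_mem 0 (Finset.mem_range.2 hd)]
    · simp; ring
    · intro i hi hi0
      rw [husum i (Nat.pos_of_ne_zero hi0) (Finset.mem_range.1 hi), mul_zero]
  have hterm : ∀ j, (1 - r ^ 2) / Complex.normSq (1 - r * u j) = 2 * ((1 - r * u j)⁻¹).re - 1 := by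
    intro j
    have hp : 0 < Complex.normSq (1 - r * u j) := Complex.normSq_pos.2 (hz j)
    rw [Complex.inv_re]
    have hN := uu_normSq r (ph d j)
    have hR := uu_re r (ph d j)
    change Complex.normSq (1 - r * u j) = _ at hN
    change (1 - r * u j).re = _ at hR
    field_simp
    rw [hR, hN]; ring
  have hre : ∑ j ∈ Finset.range d, ((1 - r * u j)⁻¹).re = d / (1 + r ^ d) := by
    rw [← Complex.re_sum, hsum]
    have : (d : ℂ) / (1 + (r : ℂ) ^ d) = ((d / (1 + r ^ d) : ℝ) : ℂ) := by push_cast; rfl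
    rw [this, Complex.ofReal_re]
  change ∑ j ∈ Finset.range d, (1 - r ^ 2) / Complex.normSq (1 - r * u j) ≤ (d : ℝ)
  simp_rw [hterm]
  rw [Finset.sum_sub_distrib, ← Finset.mul_sum, hre]
  have : (d : ℝ) / (1 + r ^ d) ≤ d := div_le_self (by positivity) (by linarith)
  simp; linarith

/-- Weights. -/
noncomputable def w (r : ℝ) (m : ℕ) : ℝ := (2 * r ^ m - (r ^ 2) ^ m) / m

lemma w_nonneg (r : ℝ) (hr0 : 0 < r) (hr1 : r < 1) (m : ℕ) : 0 ≤ w r m := by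
  unfold w
  refine div_nonneg ?_ (by positivity)
  have : (r ^ 2) ^ m ≤ r ^ m := pow_le_pow_left₀ (by positivity) (by nlinarith) m
  have : 0 < r ^ m := by positivity
  linarith

lemma hasSum_w (r φ : ℝ) (hr0 : 0 < r) (hr1 : r < 1) :
    HasSum (fun m : ℕ => (w r m : ℂ) * Complex.exp ((m * φ : ℝ) * Complex.I))
      (-2 * Complex.log (1 - r * Complex.exp (φ * Complex.I)) +
        Complex.log (1 - (r ^ 2 : ℝ) * Complex.exp (φ * Complex.I))) := by
  have hn : ∀ s : ℝ, 0 < s → s < 1 → ‖(s : ℂ) * Complex.exp (φ * Complex.I)‖ < 1 := by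
    intro s h0 h1
    rw [norm_mul, Complex.norm_exp_ofReal_mul_I, Complex.norm_real, Real.norm_of_nonneg h0.le]
    linarith
  have a := (Complex.hasSum_taylorSeries_neg_log (hn r hr0 hr1)).mul_left 2
  have b := Complex.hasSum_taylorSeries_neg_log (hn (r ^ 2) (by positivity) (by nlinarith))
  have c := a.sub b
  have e : (2 * -Complex.log (1 - r * Complex.exp (φ * Complex.I)) -
      -Complex.log (1 - (r ^ 2 : ℝ) * Complex.exp (φ * Complex.I))) =
      -2 * Complex.log (1 - r * Complex.exp (φ * Complex.I)) +
        Complex.log (1 - (r ^ 2 : ℝ) * Complex.exp (φ * Complex.I)) := by ring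
  rw [e] at c
  refine hs_congr (fun m => ?_) c
  unfold w
  rw [mul_pow, mul_pow, ← Complex.exp_nat_mul]
  push_cast
  rw [mul_assoc (m : ℂ)]
  ring

lemma hasSum_sin (r φ : ℝ) (hr0 : 0 < r) (hr1 : r < 1) :
    HasSum (fun m : ℕ => w r m * Real.sin (m * φ))
      (-2 * Complex.log (1 - r * Complex.exp (φ * Complex.I)) +
        Complex.log (1 - (r ^ 2 : ℝ) * Complex.exp (φ * Complex.I))).im := by
  convert Complex.hasSum_im (hasSum_w r φ hr0 hr1) using 2 with m
  rw [Complex.im_ofReal_mul, Complex.exp_ofReal_mul_I_im]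

lemma hasSum_cos (r φ : ℝ) (hr0 : 0 < r) (hr1 : r < 1) :
    HasSum (fun m : ℕ => w r m * Real.cos (m * φ))
      (-Real.log (1 - 2 * r * Real.cos φ + r ^ 2)
        + 1 / 2 * Real.log (1 - 2 * r ^ 2 * Real.cos φ + r ^ 4)) := by
  convert Complex.hasSum_re (hasSum_w r φ hr0 hr1) using 1
  · funext m
    rw [Complex.re_ofReal_mul, Complex.exp_ofReal_mul_I_re]
  · have h : ∀ s : ℝ, (Complex.log (1 - (s : ℂ) * Complex.exp (φ * Complex.I))).re =
        1 / 2 * Real.log (1 - 2 * s * Real.cos φ + s ^ 2) := by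
      intro s
      rw [Complex.log_re, ← uu_normSq, Complex.normSq_eq_norm_sq, Real.log_pow]
      push_cast; ring
    have h2 := h (r ^ 2)
    rw [Complex.add_re, h2]
    have : (-2 * Complex.log (1 - (r : ℂ) * Complex.exp (φ * Complex.I))).re =
        -2 * (Complex.log (1 - (r : ℂ) * Complex.exp (φ * Complex.I))).re := by
      simp
    rw [this, h]
    ring_nf

lemma hasSum_one_sub_cos (r φ : ℝ) (hr0 : 0 < r) (hr1 : r < 1) :
    ∃ V, HasSum (fun m : ℕ => w r m * (1 - Real.cos (m * φ))) V ∧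
      V ≤ Real.log (2 * ((1 + r) / (1 - r))) := by
  have a := hasSum_cos r 0 hr0 hr1
  have b := hasSum_cos r φ hr0 hr1
  refine ⟨_, hs_congr (fun m => ?_) (a.sub b), ?_⟩
  · simp; ring
  have hc := Real.neg_one_le_cos φ
  have hc' := Real.cos_le_one φ
  have p := poly_bound r (Real.cos φ) hr0 hr1 hc hc'
  set c := Real.cos φ
  have h1r : 0 < 1 - r := by linarith
  have pos1 : 0 < 1 - 2 * r * c + r ^ 2 := by nlinarith [sq_pos_of_pos h1r]
  have pos2 : 0 < 1 - 2 * r ^ 2 * c + r ^ 4 := by nlinarith [sq_pos_of_pos pos1]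
  have e1 : (1 - 2 * r * Real.cos 0 + r ^ 2) = (1 - r) ^ 2 := by simp; ring
  have e2 : (1 - 2 * r ^ 2 * Real.cos 0 + r ^ 4) = ((1 - r) * (1 + r)) ^ 2 := by simp; ring
  have l := Real.log_le_log (by positivity) p
  rw [e1, e2, Real.log_mul two_ne_zero (by positivity), Real.log_div (by positivity) (by positivity),
    Real.log_pow, Real.log_pow, Real.log_mul (by positivity) (by positivity)]
  rw [Real.log_pow, Real.log_mul (by norm_num) pos2.ne', show (4 : ℝ) = 2 ^ 2 by norm_num,
    Real.log_pow] at l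
  push_cast at l ⊢
  norm_num at l ⊢
  linarith

lemma sum_range_zmod (d : ℕ) [NeZero d] (n : ℕ) (F : ZMod d → ℂ) :
    ∑ j ∈ Finset.range d, F ((n + j : ℕ) : ZMod d) = ∑ x : ZMod d, F x := by
  rw [← Equiv.sum_comp (Equiv.addLeft (n : ZMod d)) F]
  refine Finset.sum_bij' (fun j _ => (j : ZMod d)) (fun x _ => x.val) ?_ ?_ ?_ ?_ ?_
  · intros; simp
  · intro x _; simpa using ZMod.val_lt x
  · intro j hj
    exact ZMod.val_cast_of_lt (Finset.mem_range.1 hj)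
  · intro x _; simp
  · intro j _; simp

lemma char_sum (d : ℕ) [NeZero d] (χ : DirichletCharacter ℂ d) (h : χ.IsPrimitive) (n : ℕ)
    (a : ℤ) :
    ∑ j ∈ Finset.range d, χ ((n + j : ℕ) : ZMod d) *
        Complex.exp (2 * Real.pi * Complex.I * (a * (n + j : ℕ)) / d) =
      χ⁻¹ (a : ZMod d) * gaussSum χ (ZMod.stdAddChar : AddChar (ZMod d) ℂ) := by
  rw [← gaussSum_mulShift_of_isPrimitive _ h, gaussSum, ← sum_range_zmod d n]
  refine Finset.sum_congr rfl fun j _ => ?_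
  rw [AddChar.mulShift_apply]
  have := ZMod.stdAddChar_coe (N := d) (a * (n + j : ℕ))
  push_cast at this ⊢
  rw [this]

lemma sin_sum (d : ℕ) [NeZero d] (χ : DirichletCharacter ℂ d) (h : χ.IsPrimitive) (ho : χ.Odd)
    (n m : ℕ) :
    ∑ j ∈ Finset.range d, χ ((n + j : ℕ) : ZMod d) * (Real.sin (m * ph d j) : ℂ) =
      χ⁻¹ (m : ZMod d) * gaussSum χ (ZMod.stdAddChar : AddChar (ZMod d) ℂ) * (-Complex.I) *
        (Real.cos (m * (2 * Real.pi * ((n : ℝ) - 1 / 2) / d)) : ℂ) := by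
  have hd0 : (d : ℂ) ≠ 0 := by exact_mod_cast NeZero.ne d
  set τ := gaussSum χ (ZMod.stdAddChar : AddChar (ZMod d) ℂ)
  have h1 := char_sum d χ h n m
  have h2 := char_sum d χ h n (-m)
  have hinv : χ⁻¹ (((-m : ℤ)) : ZMod d) = - χ⁻¹ (m : ZMod d) := by
    have e : (((-m : ℤ)) : ZMod d) = (-1) * (m : ZMod d) := by push_cast; ring
    have o : χ⁻¹ (-1 : ZMod d) = -1 := by
      rw [← MulChar.star_apply', show χ (-1) = -1 from ho]; simp
    rw [e, map_mul, o]; ring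
  rw [hinv] at h2
  set θ : ℝ := m * (2 * Real.pi * ((n : ℝ) - 1 / 2) / d) with hθ
  have hterm : ∀ j : ℕ, χ ((n + j : ℕ) : ZMod d) * (Real.sin (m * ph d j) : ℂ) =
      (-Complex.I / 2) * Complex.exp (-θ * Complex.I) * (χ ((n + j : ℕ) : ZMod d) *
        Complex.exp (2 * Real.pi * Complex.I * ((m : ℤ) * (n + j : ℕ)) / d)) -
      (-Complex.I / 2) * Complex.exp (θ * Complex.I) * (χ ((n + j : ℕ) : ZMod d) *
        Complex.exp (2 * Real.pi * Complex.I * ((-m : ℤ) * (n + j : ℕ)) / d)) := by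
    intro j
    have e1 : Complex.exp (-θ * Complex.I) *
        Complex.exp (2 * Real.pi * Complex.I * ((m : ℤ) * (n + j : ℕ)) / d) =
        Complex.exp ((m * ph d j : ℝ) * Complex.I) := by
      rw [← Complex.exp_add, hθ, ph]
      congr 1
      push_cast
      field_simp
      ring
    have e2 : Complex.exp (θ * Complex.I) *
        Complex.exp (2 * Real.pi * Complex.I * ((-m : ℤ) * (n + j : ℕ)) / d) =
        Complex.exp (-(m * ph d j : ℝ) * Complex.I) := by
      rw [← Complex.exp_add, hθ, ph]
      congr 1
      push_cast
      field_simp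
      ring
    rw [Complex.ofReal_sin, Complex.sin, ← e1, ← e2]
    ring
  simp_rw [hterm]
  rw [Finset.sum_sub_distrib, ← Finset.mul_sum, ← Finset.mul_sum, h1, h2, Complex.ofReal_cos,
    Complex.cos]
  push_cast
  ring

/-- Sawtooth sum. -/
noncomputable def T {d : ℕ} (χ : DirichletCharacter ℂ d) (n : ℕ) : ℂ :=
  ∑ j ∈ Finset.range d, χ ((n + j : ℕ) : ZMod d) * ((Real.pi / 2 - ph d j / 2 : ℝ) : ℂ)

lemma T_step {d : ℕ} [NeZero d] (χ : DirichletCharacter ℂ d) (ho : χ.Odd) (n : ℕ) :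
    T χ n - T χ (n + 1) = Real.pi * χ (n : ZMod d) := by
  have hd0 : (d : ℂ) ≠ 0 := by exact_mod_cast NeZero.ne d
  have hχ : χ ≠ 1 := by
    rintro rfl
    have : (1 : DirichletCharacter ℂ d) (-1) = -1 := ho
    rw [MulChar.one_apply (isUnit_one.neg)] at this
    norm_num at this
  have hz : ∑ j ∈ Finset.range d, χ ((n + 1 + j : ℕ) : ZMod d) = 0 := by
    rw [sum_range_zmod d (n + 1) (fun x => χ x)]
    exact MulChar.sum_eq_zero_of_ne_one hχ
  set f : ℕ → ℂ := fun j => χ ((n + j : ℕ) : ZMod d) * ((Real.pi / 2 - ph d j / 2 : ℝ) : ℂ) with hf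
  have h1 : T χ (n + 1) = ∑ j ∈ Finset.range d, f (j + 1) +
      (Real.pi / d) * ∑ j ∈ Finset.range d, χ ((n + 1 + j : ℕ) : ZMod d) := by
    rw [T, Finset.mul_sum, ← Finset.sum_add_distrib]
    refine Finset.sum_congr rfl fun j _ => ?_
    simp only [hf, ph]
    rw [show n + (j + 1) = n + 1 + j by ring]
    push_cast
    field_simp
    ring
  have h2 : T χ n = ∑ j ∈ Finset.range d, f j := rfl
  have h3 : ∑ j ∈ Finset.range d, f (j + 1) - ∑ j ∈ Finset.range d, f j = f d - f 0 := by
    rw [← Finset.sum_sub_distrib, Finset.sum_range_sub]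
  have h4 : f d - f 0 = - (Real.pi * χ (n : ZMod d)) := by
    simp only [hf, ph]
    push_cast
    simp only [CharP.cast_eq_zero, add_zero]
    field_simp
    ring
  rw [h1, h2, hz]
  linear_combination -h3 - h4

lemma T_sum {d : ℕ} [NeZero d] (χ : DirichletCharacter ℂ d) (ho : χ.Odd) (n m : ℕ) (h : n ≤ m) :
    Real.pi * ∑ k ∈ Finset.Icc n m, χ (k : ZMod d) = T χ n - T χ (m + 1) := by
  induction m, h using Nat.le_induction with
  | base => simp [T_step χ ho]
  | succ m hm ih =>
    rw [Finset.sum_Icc_succ_top (by omega), mul_add, ih, ← T_step χ ho]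
    ring

/-- Smoothed sawtooth sum. -/
noncomputable def G {d : ℕ} (χ : DirichletCharacter ℂ d) (r : ℝ) (n : ℕ) : ℂ :=
  ∑ j ∈ Finset.range d, χ ((n + j : ℕ) : ZMod d) *
    (((-2 * Complex.log (1 - r * Complex.exp (ph d j * Complex.I)) +
        Complex.log (1 - (r ^ 2 : ℝ) * Complex.exp (ph d j * Complex.I))).im : ℝ) : ℂ)

lemma G_sub_T {d : ℕ} [NeZero d] (χ : DirichletCharacter ℂ d) (r : ℝ) (hr0 : 0 < r) (hr1 : r < 1)
    (n : ℕ) : ‖G χ r n - T χ n‖ ≤ Real.pi / 2 * (d * ((1 - r) / (1 + r))) := by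
  have hd : 0 < d := NeZero.pos d
  have hdR : (0 : ℝ) < d := by exact_mod_cast hd
  have hpi := Real.pi_pos
  rw [G, T, ← Finset.sum_sub_distrib]
  refine (norm_sum_le _ _).trans ?_
  have hs := sum_inv d hd r hr0 hr1
  calc _ ≤ ∑ j ∈ Finset.range d, Real.pi / 2 * ((1 - r) / (1 + r)) *
        ((1 - r ^ 2) / Complex.normSq (1 - r * Complex.exp (ph d j * Complex.I))) := by
        refine Finset.sum_le_sum fun j hj => ?_
        have hjd : (j : ℝ) + 1 ≤ d := by exact_mod_cast Finset.mem_range.1 hj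
        rw [← mul_sub, norm_mul, ← Complex.ofReal_sub, Complex.norm_real, Real.norm_eq_abs]
        have h1 : 0 < ph d j := by unfold ph; positivity
        have h2 : ph d j < 2 * Real.pi := by
          unfold ph
          rw [div_lt_iff₀ hdR]
          gcongr
          linarith
        have := saw_bound r (ph d j) hr0 hr1 h1 h2
        refine (mul_le_of_le_one_left (abs_nonneg _) (χ.norm_le_one _)).trans
          (this.trans (le_of_eq ?_))
        have : 1 + r ≠ 0 := by positivity
        field_simp
        ring
    _ ≤ Real.pi / 2 * ((1 - r) / (1 + r)) * d := by
        rw [← Finset.mul_sum]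
        have : 0 ≤ 1 - r := by linarith
        gcongr
    _ = _ := by ring

lemma G_diff {d : ℕ} [NeZero d] (χ : DirichletCharacter ℂ d) (h : χ.IsPrimitive) (ho : χ.Odd)
    (r : ℝ) (hr0 : 0 < r) (hr1 : r < 1) (n n' : ℕ) :
    ‖G χ r n - G χ r n'‖ ≤ Real.sqrt d * Real.log (2 * ((1 + r) / (1 - r))) := by
  set τ := gaussSum χ (ZMod.stdAddChar : AddChar (ZMod d) ℂ) with hτ
  have hG : ∀ n : ℕ, HasSum (fun m : ℕ => (w r m : ℂ) * (χ⁻¹ (m : ZMod d) * τ * (-Complex.I) *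
        (Real.cos (m * (2 * Real.pi * ((n : ℝ) - 1 / 2) / d)) : ℂ))) (G χ r n) := by
    intro n
    have := hasSum_sum (s := Finset.range d) (fun j _ =>
      (Complex.hasSum_ofReal.2 (hasSum_sin r (ph d j) hr0 hr1)).mul_left
        (χ ((n + j : ℕ) : ZMod d)))
    refine hs_congr (fun m => ?_) this
    rw [← sin_sum d χ h ho n m, Finset.mul_sum]
    refine Finset.sum_congr rfl fun j _ => ?_
    push_cast
    ring
  set θ := 2 * Real.pi * ((n : ℝ) - 1 / 2) / d
  set θ' := 2 * Real.pi * ((n' : ℝ) - 1 / 2) / d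
  obtain ⟨V, hV, hVl⟩ := hasSum_one_sub_cos r (θ + θ') hr0 hr1
  obtain ⟨V', hV', hVl'⟩ := hasSum_one_sub_cos r (θ - θ') hr0 hr1
  have hb := ((hV.add hV').mul_left (Real.sqrt d * (1 / 2)))
  refine (((hG n).sub (hG n')).norm_le_of_bounded hb fun m => ?_).trans ?_
  · rw [← mul_sub, ← mul_sub, norm_mul, norm_mul, norm_mul, norm_mul, hτ, gauss_norm χ h,
      ← Complex.ofReal_sub, Complex.norm_real, Complex.norm_real, norm_neg, Complex.norm_I, mul_one,
      Real.norm_of_nonneg (w_nonneg r hr0 hr1 m), Real.norm_eq_abs]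
    have hc : |Real.cos (m * θ) - Real.cos (m * θ')| ≤
        1 / 2 * ((1 - Real.cos (m * (θ + θ'))) + (1 - Real.cos (m * (θ - θ')))) := by
      have s1 := Real.sin_sq_add_cos_sq (m * θ)
      have s2 := Real.sin_sq_add_cos_sq (m * θ')
      rw [mul_add (m : ℝ), mul_sub (m : ℝ), Real.cos_add, Real.cos_sub]
      have a1 := Real.cos_le_one (m * θ)
      have a2 := Real.cos_le_one (m * θ')
      have b1 := Real.neg_one_le_cos (m * θ)
      have b2 := Real.neg_one_le_cos (m * θ')
      rw [abs_le]
      constructor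
      · nlinarith [mul_nonneg (sub_nonneg.2 a2) (by linarith : 0 ≤ 1 + Real.cos (m * θ))]
      · nlinarith [mul_nonneg (sub_nonneg.2 a1) (by linarith : 0 ≤ 1 + Real.cos (m * θ'))]
    have hx : ‖χ⁻¹ (m : ZMod d)‖ ≤ 1 := DirichletCharacter.norm_le_one _ _
    have hw := w_nonneg r hr0 hr1 m
    calc _ ≤ w r m * (1 * Real.sqrt d *
          (1 / 2 * ((1 - Real.cos (m * (θ + θ'))) + (1 - Real.cos (m * (θ - θ')))))) := by gcongr
      _ = _ := by ring
  · have : 0 ≤ Real.sqrt d := Real.sqrt_nonneg _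
    calc _ ≤ Real.sqrt d * (1 / 2) * (Real.log (2 * ((1 + r) / (1 - r))) +
          Real.log (2 * ((1 + r) / (1 - r)))) := by gcongr
      _ = _ := by ring

end PV

/-- Explicit Pólya–Vinogradov inequality, odd case: for `d ≥ 3` and an odd primitive
Dirichlet character `χ` mod `d`, for all positive integers `n ≤ m`,
`|∑_{k=n}^{m} χ(k)| ≤ √d ((1/(2π)) ln d + (1/π) ln ln d + 1)`. -/
theorem stmt_6 (d : ℕ) (hd : 3 ≤ d) (χ : DirichletCharacter ℂ d)
    (hprim : χ.IsPrimitive) (hodd : χ.Odd) :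
    ∀ n m : ℕ, 0 < n → n ≤ m →
      ‖∑ k ∈ Finset.Icc n m, χ (k : ZMod d)‖ ≤
        Real.sqrt d * (1 / (2 * Real.pi) * Real.log d
          + 1 / Real.pi * Real.log (Real.log d) + 1) := by
  intro n m _ hnm
  have : NeZero d := ⟨by omega⟩
  have hpi := Real.pi_pos
  have hpi3 := Real.pi_gt_three
  have hdR : (3 : ℝ) ≤ d := by exact_mod_cast hd
  set q := Real.sqrt d with hq
  have hqq : q * q = d := Real.mul_self_sqrt (by linarith)
  have hq1 : 1 < q := by
    rw [hq]; exact Real.lt_sqrt_of_sq_lt (by linarith)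
  -- the smoothing parameter
  set ε := 1 / (Real.pi * q) with hε
  have hε0 : 0 < ε := by positivity
  have hε1 : ε < 1 := by
    rw [hε, div_lt_one (by positivity)]; nlinarith
  set r := (1 - ε) / (1 + ε) with hr
  have hr0 : 0 < r := div_pos (by linarith) (by linarith)
  have hr1 : r < 1 := by rw [hr, div_lt_one (by linarith)]; linarith
  have hrε : (1 - r) / (1 + r) = ε := by
    rw [hr]; field_simp; ring
  have hrε' : (1 + r) / (1 - r) = Real.pi * q := by
    rw [← inv_div, hrε, hε]; simp
  have t1 := PV.G_sub_T χ r hr0 hr1 n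
  have t2 := PV.G_sub_T χ r hr0 hr1 (m + 1)
  have t3 := PV.G_diff χ hprim hodd r hr0 hr1 n (m + 1)
  rw [hrε] at t1 t2
  rw [hrε'] at t3
  have hS := PV.T_sum χ hodd n m hnm
  have hSn : Real.pi * ‖∑ k ∈ Finset.Icc n m, χ (k : ZMod d)‖ = ‖PV.T χ n - PV.T χ (m + 1)‖ := by
    rw [← hS, norm_mul, Complex.norm_real, Real.norm_of_nonneg hpi.le]
  have hdec : PV.T χ n - PV.T χ (m + 1) = (PV.G χ r n - PV.G χ r (m + 1)) -
      (PV.G χ r n - PV.T χ n) + (PV.G χ r (m + 1) - PV.T χ (m + 1)) := by ring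
  have hle : ‖PV.T χ n - PV.T χ (m + 1)‖ ≤ q * Real.log (2 * (Real.pi * q)) +
      Real.pi * (d * ε) := by
    rw [hdec]
    refine (norm_add_le _ _).trans ?_
    have := norm_sub_le (PV.G χ r n - PV.G χ r (m + 1)) (PV.G χ r n - PV.T χ n)
    linarith
  have hdε : Real.pi * (d * ε) = q := by
    rw [hε, ← hqq]; field_simp
  have hlog : Real.log (2 * (Real.pi * q)) = Real.log (2 * Real.pi) + 1 / 2 * Real.log d := by
    rw [← mul_assoc, Real.log_mul (by positivity) (by positivity), hq, Real.log_sqrt (by linarith)]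
    ring
  have hll : 0 ≤ Real.log (Real.log d) := by
    refine Real.log_nonneg ?_
    rw [Real.le_log_iff_exp_le (by linarith)]
    linarith [Real.exp_one_lt_d9]
  have h2pi : Real.log (2 * Real.pi) + 1 ≤ Real.pi := by
    have hp := Real.pi_lt_d2
    have : Real.log (2 * Real.pi) ≤ 2 := by
      rw [Real.log_le_iff_le_exp (by positivity)]
      have e := Real.exp_one_gt_d9
      have : Real.exp 2 = Real.exp 1 * Real.exp 1 := by rw [← Real.exp_add]; norm_num
      nlinarith
    linarith
  rw [hdε, hlog, ← hSn] at hle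
  have : Real.pi * ‖∑ k ∈ Finset.Icc n m, χ (k : ZMod d)‖ ≤
      Real.pi * (q * (1 / (2 * Real.pi) * Real.log d
          + 1 / Real.pi * Real.log (Real.log d) + 1)) := by
    have e : Real.pi * (q * (1 / (2 * Real.pi) * Real.log d
          + 1 / Real.pi * Real.log (Real.log d) + 1)) =
        q * (1 / 2 * Real.log d + Real.log (Real.log d) + Real.pi) := by
      field_simp
    rw [e]
    refine hle.trans ?_
    nlinarith
  exact le_of_mul_le_mul_left this hpi
end

section
/- Let d be a negative fundamental discriminant with |d| ≥ 3 and let χ be the associated odd primitive quadratic Dirichlet character modulo |d| (the Kronecker symbol χ(m) = (d/m)). Then L(1, χ) ≤ (1/2 + 1/(2π)) · ln|d| + (1/π) · ln ln|d| + 1. -/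
section Helpers

open Complex Filter Topology MeasureTheory Set HurwitzZeta

lemma aux_ne {z : ℂ} (hz : ‖z‖ = 1) (hz1 : z ≠ 1) {t : ℝ} (ht : 0 ≤ t) :
    1 - z * cexp (-t) ∈ slitPlane := by
  left
  have hn : ‖z * cexp (-t)‖ = Real.exp (-t) := by
    rw [norm_mul, hz, one_mul, norm_exp]; simp
  have h1 : (z * cexp (-t)).re ≤ Real.exp (-t) := hn ▸ re_le_norm _
  have h2 : Real.exp (-t) ≤ 1 := Real.exp_le_one_iff.2 (by linarith)
  simp only [sub_re, one_re]
  rcases ht.eq_or_lt with rfl | ht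
  · have : z.re ≤ 1 := hz ▸ re_le_norm z
    rcases this.eq_or_lt with h | h
    · exfalso; apply hz1
      have h3 : z.re ^ 2 + z.im ^ 2 = 1 := by
        have := Complex.sq_norm z
        rw [hz, normSq_apply] at this; nlinarith
      apply Complex.ext
      · simpa using h
      · simp; rw [h] at h3; nlinarith
    · simpa using h
  · have : Real.exp (-t) < 1 := by simpa using ht
    linarith

lemma expZeta_one {x : ℝ} (hx0 : 0 < x) (hx1 : x < 1) :
    expZeta (x : UnitAddCircle) 1 = - Complex.log (1 - cexp (2 * Real.pi * I * x)) := by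
  set z := cexp (2 * Real.pi * I * x) with hzdef
  have hz : ‖z‖ = 1 := by
    rw [hzdef, show (2 * Real.pi * I * x : ℂ) = ((2 * Real.pi * x : ℝ) : ℂ) * I by push_cast; ring]
    exact norm_exp_ofReal_mul_I _
  have hz1 : z ≠ 1 := by
    rw [hzdef, Ne, Complex.exp_eq_one_iff]
    rintro ⟨n, hn⟩
    have hn' : (x : ℂ) = n := by
      have : (2 * Real.pi * I : ℂ) ≠ 0 := two_pi_I_ne_zero
      apply mul_left_cancel₀ this
      rw [hn]; ring
    have hn2 : x = n := by exact_mod_cast hn'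
    rw [hn2] at hx0 hx1
    have a : 0 < n := by exact_mod_cast hx0
    have b : n < 1 := by exact_mod_cast hx1
    omega
  have ha : (x : UnitAddCircle) ≠ 0 := by
    rw [Ne, AddCircle.coe_eq_zero_iff]
    rintro ⟨n, hn⟩
    have hn2 : x = n := by rw [← hn]; simp
    rw [hn2] at hx0 hx1
    have a : 0 < n := by exact_mod_cast hx0
    have b : n < 1 := by exact_mod_cast hx1
    omega
  set F : ℝ → ℂ := fun t => z * cexp (-t) / (1 - z * cexp (-t)) with hF
  have hnorm : ∀ t : ℝ, ‖z * cexp (-t)‖ = Real.exp (-t) := by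
    intro t
    rw [norm_mul, hz, one_mul, norm_exp]; simp
  have hcont : ContinuousOn F (Ici 0) := by
    apply ContinuousOn.div
    · fun_prop
    · fun_prop
    · intro t ht; exact slitPlane_ne_zero (aux_ne hz hz1 ht)
  have hloc : LocallyIntegrableOn F (Ioi 0) :=
    (hcont.mono Ioi_subset_Ici_self).locallyIntegrableOn measurableSet_Ioi
  have htop : F =O[atTop] fun t => Real.exp (-1 * t) := by
    apply Asymptotics.IsBigO.of_bound 2
    filter_upwards [eventually_ge_atTop (1 : ℝ)] with t ht
    have h1 : Real.exp (-t) ≤ 1 / 2 := by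
      have : Real.exp (-t) ≤ Real.exp (-1) := Real.exp_le_exp.2 (by linarith)
      have := Real.exp_neg_one_lt_d9
      linarith
    have h2 : 1 / 2 ≤ ‖1 - z * cexp (-t)‖ := by
      have := norm_sub_norm_le (1 : ℂ) (z * cexp (-t))
      rw [hnorm, norm_one] at this; linarith
    simp only [hF]
    rw [norm_div, hnorm, Real.norm_of_nonneg (Real.exp_pos _).le, div_le_iff₀ (by linarith), neg_one_mul]
    nlinarith [Real.exp_pos (-t)]
  have hbot : F =O[𝓝[>] 0] (fun t : ℝ => t ^ (-(0:ℝ))) := by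
    have h1 : Tendsto F (𝓝[>] 0) (𝓝 (F 0)) :=
      (hcont 0 self_mem_Ici).tendsto.mono_left (nhdsWithin_mono _ Ioi_subset_Ici_self)
    simpa using h1.isBigO_one ℝ
  have hdiff : DifferentiableAt ℂ (mellin F) 1 :=
    mellin_differentiableAt_of_isBigO_rpow_exp one_pos hloc htop hbot (by simp)
  have hconv : MellinConvergent F 1 :=
    mellinConvergent_of_isBigO_rpow_exp one_pos hloc htop hbot (by simp)
  have key : ∀ s : ℝ, 1 < s → Gamma s * expZeta (x : UnitAddCircle) s = mellin F s := by
    intro s hs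
    have h1 : HasSum (fun n : ℕ => Gamma s * z ^ (n + 1) / (((n : ℝ) + 1 : ℝ) : ℂ) ^ (s : ℂ)) (mellin F s) := by
      apply hasSum_mellin (p := fun n : ℕ => (n : ℝ) + 1)
      · intro i; right; positivity
      · simp; linarith
      · intro t ht
        have hw : ‖z * cexp (-t)‖ < 1 := by
          rw [hnorm]; simpa using ht
        have := (hasSum_geometric_of_norm_lt_one hw).mul_left (z * cexp (-t))
        simp only [hF, div_eq_mul_inv]
        refine this.congr_fun fun n => ?_
        have he : cexp (-t) ^ (n + 1) = cexp (-((n : ℂ) + 1) * t) := by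
          rw [← Complex.exp_nat_mul]; congr 1; push_cast; ring
        rw [← pow_succ', mul_pow, he, Complex.ofReal_exp]
        push_cast
        rfl
      · simp only [norm_pow, hz, one_pow, ofReal_re]
        have := (Real.summable_one_div_nat_rpow (p := s)).2 hs
        simpa using (summable_nat_add_iff 1).2 this
    have h2 := (hasSum_expZeta_of_one_lt_re x (s := s) (by simpa using hs))
    have h3 := ((hasSum_nat_add_iff' 1).2 h2).mul_left (Gamma s)
    have h0 : (s : ℂ) ≠ 0 := by exact_mod_cast (by linarith : s ≠ 0)
    simp [h0] at h3
    refine h3.unique (h1.congr_fun fun n => ?_)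
    rw [hzdef, ← Complex.exp_nat_mul]
    push_cast
    rw [mul_div_assoc, mul_comm ((n:ℂ)+1) (2 * Real.pi * I * x)]
  have lim1 : Tendsto (fun s : ℝ => Gamma s * expZeta (x : UnitAddCircle) s) (𝓝[>] 1)
      (𝓝 (Gamma (1:ℝ) * expZeta (x : UnitAddCircle) (1:ℝ))) := by
    have c1 : ContinuousAt (fun s : ℝ => Gamma s * expZeta (x : UnitAddCircle) s) 1 := by
      apply ContinuousAt.mul
      · apply ContinuousAt.comp (g := Gamma) _ continuous_ofReal.continuousAt
        apply (differentiableAt_Gamma _ _).continuousAt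
        intro m hm
        have : (1:ℝ) = -m := by exact_mod_cast hm
        have : (0:ℝ) ≤ m := Nat.cast_nonneg m
        linarith
      · apply ContinuousAt.comp (g := expZeta (x : UnitAddCircle)) _ continuous_ofReal.continuousAt
        exact (differentiable_expZeta_of_ne_zero ha _).continuousAt
    exact c1.tendsto.mono_left nhdsWithin_le_nhds
  have lim2 : Tendsto (fun s : ℝ => mellin F s) (𝓝[>] 1) (𝓝 (mellin F (1:ℝ))) := by
    have c1 : ContinuousAt (fun s : ℝ => mellin F s) 1 := by
      apply ContinuousAt.comp (g := mellin F) _ continuous_ofReal.continuousAt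
      simpa using hdiff.continuousAt
    exact c1.tendsto.mono_left nhdsWithin_le_nhds
  have e1 : Gamma (1:ℝ) * expZeta (x : UnitAddCircle) (1:ℝ) = mellin F (1:ℝ) := by
    refine tendsto_nhds_unique (lim1.congr' ?_) lim2
    filter_upwards [self_mem_nhdsWithin] with s hs using key s hs
  simp only [ofReal_one, Complex.Gamma_one, one_mul] at e1
  rw [e1, mellin]
  simp only [sub_self, cpow_zero, one_smul]
  have hint : IntegrableOn F (Ioi 0) := by simpa [MellinConvergent] using hconv
  have := integral_Ioi_of_hasDerivAt_of_tendsto' (a := 0) (m := 0)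
    (f := fun t : ℝ => Complex.log (1 - z * cexp (-t))) (f' := F) ?_ hint ?_
  · rw [this]; simp
  · intro t ht
    have hd : HasDerivAt (fun t : ℝ => 1 - z * cexp (-t)) (z * cexp (-t)) t := by
      have h0 : HasDerivAt (fun t : ℝ => (-t : ℂ)) (-1) t := (HasDerivAt.ofReal_comp (hasDerivAt_id t)).neg
      have := (h0.cexp.const_mul z).const_sub 1
      simpa using this
    exact hd.clog_real (aux_ne hz hz1 ht)
  · have h1 : Tendsto (fun t : ℝ => 1 - z * cexp (-t)) atTop (𝓝 1) := by
      have : Tendsto (fun t : ℝ => z * cexp (-t)) atTop (𝓝 0) := by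
        rw [tendsto_zero_iff_norm_tendsto_zero]
        simp only [hnorm]
        exact Real.tendsto_exp_neg_atTop_nhds_zero
      simpa using this.const_sub 1
    have h2 := (continuousAt_clog (by simp : (1:ℂ) ∈ slitPlane)).tendsto.comp h1
    simpa [Function.comp_def] using h2

lemma expZeta_one' {x : ℝ} (hx0 : 0 < x) (hx1 : x < 1) :
    expZeta (x : UnitAddCircle) 1 =
      ((-Real.log (2 * Real.sin (Real.pi * x)) : ℝ) : ℂ) + I * ((Real.pi * (1 / 2 - x) : ℝ) : ℂ) := by
  rw [expZeta_one hx0 hx1]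
  have hs : 0 < Real.sin (Real.pi * x) := Real.sin_pos_of_pos_of_lt_pi (by positivity)
    (by nlinarith [Real.pi_pos])
  have h1 : 1 - cexp (2 * Real.pi * I * x) =
      ((2 * Real.sin (Real.pi * x) : ℝ) : ℂ) * cexp (((Real.pi * (x - 1 / 2) : ℝ) : ℂ) * I) := by
    have e1 : (((Real.pi * (x - 1 / 2) : ℝ) : ℂ) * I) = (Real.pi * x) * I + -(Real.pi / 2 * I) := by
      push_cast; ring
    have e2 : (2 * Real.pi * I * x : ℂ) = (Real.pi * x) * I + (Real.pi * x) * I := by ring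
    rw [e1, e2, Complex.exp_add, Complex.exp_add, Complex.exp_neg, Complex.exp_pi_div_two_mul_I]
    push_cast
    rw [Complex.sin]
    have h3 : cexp (-(Real.pi * x) * I) = (cexp ((Real.pi * x) * I))⁻¹ := by
      rw [← Complex.exp_neg]; ring_nf
    have h4 : cexp ((Real.pi * x) * I) ≠ 0 := Complex.exp_ne_zero _
    rw [h3]
    field_simp
  rw [h1, Complex.log_ofReal_mul (by positivity) (Complex.exp_ne_zero _), Complex.log_exp]
  · push_cast; ring
  · simp; nlinarith [Real.pi_pos]
  · simp; nlinarith [Real.pi_pos]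

open Finset

noncomputable def dD (N : ℕ) (θ : ℝ) : ℝ := Real.pi * (1 / 2 - θ) -
  ∑ n ∈ range N, (1 / ((n : ℝ) + 1) - 1 / N) * Real.sin (2 * Real.pi * (n + 1) * θ)

noncomputable def pP (N : ℕ) (θ : ℝ) : ℝ := Real.pi * (θ / 2 - θ ^ 2 / 2) +
  ∑ n ∈ range N, (1 / ((n : ℝ) + 1) - 1 / N) *
    ((Real.cos (2 * Real.pi * (n + 1) * θ) - 1) / (2 * Real.pi * (n + 1)))

lemma fejer (N : ℕ) (t : ℝ) :
    (N : ℝ) + 2 * ∑ n ∈ range N, ((N : ℝ) - (n + 1)) * Real.cos ((n + 1) * t) =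
      (∑ n ∈ range N, Real.cos (n * t)) ^ 2 + (∑ n ∈ range N, Real.sin (n * t)) ^ 2 := by
  induction N with
  | zero => simp
  | succ N ih =>
    have h1 : ∑ n ∈ range (N + 1), (((N + 1 : ℕ) : ℝ) - (n + 1)) * Real.cos ((n + 1) * t)
        = ∑ n ∈ range N, ((N : ℝ) - (n + 1)) * Real.cos ((n + 1) * t) +
          ∑ n ∈ range N, Real.cos ((n + 1) * t) := by
      rw [sum_range_succ, ← sum_add_distrib]
      push_cast
      simp only [sub_self, zero_mul, add_zero]
      exact sum_congr rfl fun n _ => by ring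
    have h2 : ∑ n ∈ range N, Real.cos (((n : ℝ) + 1) * t) =
        Real.cos (N * t) * (∑ n ∈ range N, Real.cos (n * t)) +
        Real.sin (N * t) * (∑ n ∈ range N, Real.sin (n * t)) := by
      rw [mul_sum, mul_sum, ← sum_add_distrib, ← sum_range_reflect]
      refine sum_congr rfl fun n hn => ?_
      rw [Finset.mem_range] at hn
      rw [← Real.cos_sub]
      congr 1
      have : ((N - 1 - n : ℕ) : ℝ) = N - 1 - n := by
        rw [Nat.sub_sub, Nat.cast_sub (by omega)]; push_cast; ring
      rw [this]; ring
    rw [h1, sum_range_succ (fun n : ℕ => Real.cos (n * t)), sum_range_succ (fun n : ℕ => Real.sin (n * t))]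
    have h3 := Real.sin_sq_add_cos_sq (N * t)
    push_cast
    linear_combination ih + 2 * h2 - h3

lemma pP_hasDeriv (N : ℕ) (θ : ℝ) : HasDerivAt (pP N) (dD N θ) θ := by
  unfold pP dD
  have h1 : HasDerivAt (fun θ : ℝ => Real.pi * (θ / 2 - θ ^ 2 / 2)) (Real.pi * (1 / 2 - θ)) θ := by
    have := (((hasDerivAt_id θ).div_const 2).sub ((hasDerivAt_pow 2 θ).div_const 2)).const_mul Real.pi
    refine this.congr_deriv ?_
    simp
  rw [sub_eq_add_neg, ← sum_neg_distrib]
  refine h1.add (HasDerivAt.fun_sum fun n _ => ?_)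
  have h2 : HasDerivAt (fun θ : ℝ => 2 * Real.pi * (n + 1) * θ) (2 * Real.pi * (n + 1)) θ := by
    simpa using (hasDerivAt_id θ).const_mul (2 * Real.pi * ((n : ℝ) + 1))
  have := ((h2.cos.sub_const 1).div_const (2 * Real.pi * ((n : ℝ) + 1))).const_mul (1 / ((n : ℝ) + 1) - 1 / N)
  refine this.congr_deriv ?_
  have : (n : ℝ) + 1 ≠ 0 := by positivity
  have := Real.pi_ne_zero
  field_simp

lemma dD_hasDeriv (N : ℕ) (hN : 0 < N) (θ : ℝ) : HasDerivAt (dD N)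
    (-(Real.pi / N) * ((∑ n ∈ range N, Real.cos (n * (2 * Real.pi * θ))) ^ 2 +
      (∑ n ∈ range N, Real.sin (n * (2 * Real.pi * θ))) ^ 2)) θ := by
  rw [← fejer]
  unfold dD
  have h1 : HasDerivAt (fun θ : ℝ => Real.pi * (1 / 2 - θ)) (-Real.pi) θ := by
    exact (((hasDerivAt_id θ).const_sub (1 / 2)).const_mul Real.pi).congr_deriv (by ring)
  have h3 : HasDerivAt (fun θ : ℝ => ∑ n ∈ range N, (1 / ((n : ℝ) + 1) - 1 / N) *
      Real.sin (2 * Real.pi * (n + 1) * θ))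
      (∑ n ∈ range N, (1 / ((n : ℝ) + 1) - 1 / N) *
       (Real.cos (2 * Real.pi * (n + 1) * θ) * (2 * Real.pi * (n + 1)))) θ := by
    refine HasDerivAt.fun_sum fun n _ => ?_
    have h2 : HasDerivAt (fun θ : ℝ => 2 * Real.pi * (n + 1) * θ) (2 * Real.pi * (n + 1)) θ := by
      simpa using (hasDerivAt_id θ).const_mul (2 * Real.pi * ((n : ℝ) + 1))
    exact h2.sin.const_mul _
  refine (h1.sub h3).congr_deriv ?_
  have hN' : (N : ℝ) ≠ 0 := by positivity
  have : ∑ n ∈ range N, (1 / ((n : ℝ) + 1) - 1 / N) *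
       (Real.cos (2 * Real.pi * (n + 1) * θ) * (2 * Real.pi * (n + 1))) =
       (Real.pi / N) * (2 * ∑ n ∈ range N, ((N : ℝ) - (n + 1)) * Real.cos ((n + 1) * (2 * Real.pi * θ))) := by
    rw [mul_sum, mul_sum]
    refine sum_congr rfl fun n _ => ?_
    rw [show 2 * Real.pi * ((n : ℝ) + 1) * θ = (n + 1) * (2 * Real.pi * θ) by ring]
    have : (n : ℝ) + 1 ≠ 0 := by positivity
    field_simp
  rw [this]
  generalize ∑ n ∈ range N, ((N : ℝ) - (n + 1)) * Real.cos ((n + 1) * (2 * Real.pi * θ)) = S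
  field_simp
  ring

lemma dD_antitone (N : ℕ) (hN : 0 < N) : Antitone (dD N) := by
  apply antitone_of_deriv_nonpos
  · exact fun θ => (dD_hasDeriv N hN θ).differentiableAt
  · intro θ
    rw [(dD_hasDeriv N hN θ).deriv]
    have : 0 ≤ Real.pi / N := by positivity
    nlinarith [sq_nonneg (∑ n ∈ range N, Real.cos (n * (2 * Real.pi * θ))),
      sq_nonneg (∑ n ∈ range N, Real.sin (n * (2 * Real.pi * θ)))]

lemma dD_half (N : ℕ) : dD N (1 / 2) = 0 := by
  unfold dD
  rw [sum_eq_zero]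
  · ring
  · intro n _
    rw [show 2 * Real.pi * ((n : ℝ) + 1) * (1 / 2) = ((n + 1 : ℕ) : ℝ) * Real.pi by push_cast; ring,
      Real.sin_nat_mul_pi, mul_zero]

lemma pP_zero (N : ℕ) : pP N 0 = 0 := by simp [pP]

lemma pP_one (N : ℕ) : pP N 1 = 0 := by
  unfold pP
  rw [sum_eq_zero]
  · ring
  · intro n _
    rw [show 2 * Real.pi * ((n : ℝ) + 1) * 1 = ((n + 1 : ℕ) : ℝ) * (2 * Real.pi) by push_cast; ring,
      Real.cos_nat_mul_two_pi]
    simp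

lemma pP_mvt (N : ℕ) {a b : ℝ} (hab : a < b) : ∃ c, a < c ∧ c < b ∧ pP N b - pP N a = dD N c * (b - a) := by
  obtain ⟨c, ⟨h1, h2⟩, h3⟩ := exists_hasDerivAt_eq_slope (pP N) (dD N) hab
    (fun x _ => (pP_hasDeriv N x).continuousAt.continuousWithinAt) (fun x _ => pP_hasDeriv N x)
  refine ⟨c, h1, h2, ?_⟩
  rw [h3]
  have : b - a ≠ 0 := by linarith
  field_simp

lemma pP_le_half (N : ℕ) (hN : 0 < N) (θ : ℝ) : pP N θ ≤ pP N (1 / 2) := by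
  rcases lt_trichotomy θ (1 / 2) with h | h | h
  · obtain ⟨c, h1, h2, h3⟩ := pP_mvt N h
    have := dD_antitone N hN h2.le
    rw [dD_half] at this
    nlinarith
  · rw [h]
  · obtain ⟨c, h1, h2, h3⟩ := pP_mvt N h
    have := dD_antitone N hN h1.le
    rw [dD_half] at this
    nlinarith

lemma dD_sum (N q : ℕ) (hN : 0 < N) (hq : 0 < q) :
    ∑ a ∈ range (q - 1), |dD N (((a + 1 : ℕ) : ℝ) / q)| ≤ 2 * q * pP N (1 / 2) := by
  have hq' : (0 : ℝ) < q := by exact_mod_cast hq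
  obtain ⟨r, hr⟩ : ∃ r, q - 1 = q / 2 + r := ⟨q - 1 - q / 2, by omega⟩
  rw [hr, sum_range_add]
  have step : ∀ a : ℕ, ((a + 1 : ℕ) : ℝ) / q - (a : ℝ) / q = 1 / q := by
    intro a; push_cast; ring
  have steplt : ∀ a : ℕ, (a : ℝ) / q < ((a + 1 : ℕ) : ℝ) / q := by
    intro a
    have := step a
    have : 0 < 1 / (q : ℝ) := by positivity
    linarith
  have s1 : ∑ a ∈ range (q / 2), |dD N (((a + 1 : ℕ) : ℝ) / q)| ≤ q * pP N (1 / 2) := by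
    calc _ ≤ ∑ a ∈ range (q / 2), (q * pP N (((a + 1 : ℕ) : ℝ) / q) - q * pP N ((a : ℝ) / q)) := by
          refine sum_le_sum fun a ha => ?_
          rw [Finset.mem_range] at ha
          have h1 : ((a + 1 : ℕ) : ℝ) / q ≤ 1 / 2 := by
            rw [div_le_div_iff₀ hq' two_pos]
            have : (a + 1) * 2 ≤ 1 * q := by omega
            exact_mod_cast this
          have h2 := dD_antitone N hN h1
          rw [dD_half] at h2
          rw [abs_of_nonneg h2]
          obtain ⟨c, h3, h4, h5⟩ := pP_mvt N (steplt a)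
          rw [step] at h5
          have := dD_antitone N hN h4.le
          rw [← mul_sub, h5]
          field_simp
          exact this
      _ = q * pP N (((q / 2 : ℕ) : ℝ) / q) - q * pP N (((0 : ℕ) : ℝ) / q) :=
          sum_range_sub (fun a : ℕ => q * pP N ((a : ℝ) / q)) _
      _ ≤ q * pP N (1 / 2) := by
          simp only [Nat.cast_zero, zero_div, pP_zero, mul_zero, sub_zero]
          exact mul_le_mul_of_nonneg_left (pP_le_half N hN _) hq'.le
  have s2 : ∑ a ∈ range r, |dD N (((q / 2 + a + 1 : ℕ) : ℝ) / q)| ≤ q * pP N (1 / 2) := by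
    calc _ ≤ ∑ a ∈ range r, (q * pP N (((q / 2 + a + 1 : ℕ) : ℝ) / q) -
              q * pP N (((q / 2 + (a + 1) + 1 : ℕ) : ℝ) / q)) := by
          refine sum_le_sum fun a ha => ?_
          rw [Finset.mem_range] at ha
          have h1 : 1 / 2 ≤ ((q / 2 + a + 1 : ℕ) : ℝ) / q := by
            rw [div_le_div_iff₀ two_pos hq']
            have : 1 * q ≤ (q / 2 + a + 1) * 2 := by omega
            exact_mod_cast this
          have h2 := dD_antitone N hN h1
          rw [dD_half] at h2
          rw [abs_of_nonpos h2]
          obtain ⟨c, h3, h4, h5⟩ := pP_mvt N (steplt (q / 2 + a + 1))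
          rw [step] at h5
          have := dD_antitone N hN h3.le
          rw [show q / 2 + (a + 1) + 1 = q / 2 + a + 1 + 1 by ring, ← mul_sub, ← neg_sub, h5]
          field_simp
          linarith
      _ = q * pP N (((q / 2 + 0 + 1 : ℕ) : ℝ) / q) - q * pP N (((q / 2 + r + 1 : ℕ) : ℝ) / q) :=
          sum_range_sub' (fun a : ℕ => q * pP N (((q / 2 + a + 1 : ℕ) : ℝ) / q)) _
      _ ≤ q * pP N (1 / 2) := by
          rw [show q / 2 + r + 1 = q by omega, div_self hq'.ne', pP_one, mul_zero, sub_zero]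
          exact mul_le_mul_of_nonneg_left (pP_le_half N hN _) hq'.le
  linarith

lemma hasSum_odd_sq : HasSum (fun k : ℕ => 1 / (2 * (k : ℝ) + 1) ^ 2) (Real.pi ^ 2 / 8) := by
  have h := hasSum_zeta_two
  have he : HasSum (fun k : ℕ => 1 / ((2 * k : ℕ) : ℝ) ^ 2) (Real.pi ^ 2 / 24) := by
    have := h.mul_left (1 / 4)
    rw [show (1 / 4 : ℝ) * (Real.pi ^ 2 / 6) = Real.pi ^ 2 / 24 by ring] at this
    refine this.congr_fun fun k => ?_
    push_cast
    rw [mul_pow, one_div_mul_one_div]; norm_num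
  have ho : Summable (fun k : ℕ => 1 / ((2 * k + 1 : ℕ) : ℝ) ^ 2) :=
    h.summable.comp_injective (i := fun k : ℕ => 2 * k + 1) (fun a b hab => by simpa using hab)
  have := (HasSum.even_add_odd (f := fun n : ℕ => 1 / (n : ℝ) ^ 2) he ho.hasSum).unique h
  have h2 : ∑' k : ℕ, 1 / ((2 * k + 1 : ℕ) : ℝ) ^ 2 = Real.pi ^ 2 / 8 := by linarith
  rw [← h2]
  have := ho.hasSum
  push_cast at this ⊢
  exact this

lemma odd_sq_tail (M : ℕ) (hM : 0 < M) :
    Real.pi ^ 2 / 8 ≤ ∑ k ∈ range M, 1 / (2 * (k : ℝ) + 1) ^ 2 + 1 / (4 * M) := by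
  have key : ∀ j : ℕ, ∑ k ∈ range (M + j), 1 / (2 * (k : ℝ) + 1) ^ 2 + 1 / (4 * ((M + j : ℕ) : ℝ)) ≤
      ∑ k ∈ range M, 1 / (2 * (k : ℝ) + 1) ^ 2 + 1 / (4 * M) := by
    intro j
    induction j with
    | zero => simp
    | succ j ih =>
      refine le_trans ?_ ih
      rw [← add_assoc, sum_range_succ]
      have : 1 / (2 * ((M + j : ℕ) : ℝ) + 1) ^ 2 + 1 / (4 * ((M + j + 1 : ℕ) : ℝ)) ≤
          1 / (4 * ((M + j : ℕ) : ℝ)) := by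
        have hx : (0 : ℝ) < ((M + j : ℕ) : ℝ) := by exact_mod_cast (by omega)
        rw [Nat.cast_add_one (M + j)]
        set x := ((M + j : ℕ) : ℝ)
        have e : 1 / (4 * x) - 1 / (4 * (x + 1)) = 1 / (4 * x * (x + 1)) := by field_simp; ring
        have : 1 / (2 * x + 1) ^ 2 ≤ 1 / (4 * x * (x + 1)) :=
          one_div_le_one_div_of_le (by positivity) (by nlinarith)
        linarith
      linarith
  refine le_of_tendsto' (f := fun j : ℕ => ∑ k ∈ range (j + M), 1 / (2 * (k : ℝ) + 1) ^ 2)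
    (x := Filter.atTop) ((Filter.tendsto_add_atTop_iff_nat M).2 hasSum_odd_sq.tendsto_sum_nat) fun j => ?_
  refine le_trans ?_ (key j)
  rw [add_comm j M]
  have : 0 ≤ 1 / (4 * ((M + j : ℕ) : ℝ)) := by positivity
  linarith

lemma sum_range_two_mul (f : ℕ → ℝ) (M : ℕ) :
    ∑ n ∈ range (2 * M), f n = ∑ k ∈ range M, (f (2 * k) + f (2 * k + 1)) := by
  induction M with
  | zero => simp
  | succ M ih => rw [mul_add, mul_one, sum_range_succ, sum_range_succ, sum_range_succ, ih]; ring

lemma harm (n : ℕ) : (harmonic n : ℝ) = ∑ k ∈ range n, 1 / ((k : ℝ) + 1) := by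
  simp [harmonic]

lemma harm_odd (M : ℕ) : ∑ k ∈ range M, 1 / (2 * (k : ℝ) + 1) = harmonic (2 * M) - 1 / 2 * harmonic M := by
  rw [harm, harm, sum_range_two_mul, mul_sum, ← sum_sub_distrib]
  refine sum_congr rfl fun k _ => ?_
  push_cast
  field_simp
  ring

lemma pP_half_le (M : ℕ) (hM : 0 < M) : pP (2 * M) (1 / 2) ≤
    1 / (2 * Real.pi * M) * (1 / 2 + harmonic (2 * M) - 1 / 2 * harmonic M) := by
  have h : pP (2 * M) (1 / 2) = Real.pi / 8 - 1 / Real.pi * ∑ k ∈ range M, 1 / (2 * (k : ℝ) + 1) ^ 2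
      + 1 / (2 * Real.pi * M) * ∑ k ∈ range M, 1 / (2 * (k : ℝ) + 1) := by
    unfold pP
    rw [sum_range_two_mul, mul_sum, mul_sum, sub_add, ← sum_sub_distrib,
      sub_eq_add_neg (Real.pi / 8), ← sum_neg_distrib]
    congr 1
    · ring
    · refine sum_congr rfl fun k _ => ?_
      rw [show 2 * Real.pi * (((2 * k : ℕ) : ℝ) + 1) * (1 / 2) = Real.pi + (k : ℝ) * (2 * Real.pi) by push_cast; ring,
        show 2 * Real.pi * (((2 * k + 1 : ℕ) : ℝ) + 1) * (1 / 2) = ((k + 1 : ℕ) : ℝ) * (2 * Real.pi) by push_cast; ring,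
        Real.cos_nat_mul_two_pi, Real.cos_add_nat_mul_two_pi, Real.cos_pi]
      have := Real.pi_ne_zero
      push_cast
      field_simp
      ring
  have h2 := odd_sq_tail M hM
  rw [h, harm_odd]
  have hpi := Real.pi_pos
  have h3 : 1 / Real.pi * (Real.pi ^ 2 / 8) ≤ 1 / Real.pi * (∑ k ∈ range M, 1 / (2 * (k : ℝ) + 1) ^ 2 + 1 / (4 * M)) :=
    mul_le_mul_of_nonneg_left h2 (by positivity)
  have h4 : 1 / Real.pi * (Real.pi ^ 2 / 8) = Real.pi / 8 := by field_simp
  have h5 : 1 / Real.pi * (1 / (4 * (M : ℝ))) = 1 / (2 * Real.pi * M) * (1 / 2) := by field_simp; norm_num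
  rw [h4, mul_add, h5] at h3
  linarith


open scoped ZMod
lemma dft_quad {q : ℕ} [NeZero q] {χ : DirichletCharacter ℂ q}
    (hprim : χ.IsPrimitive) (hquad : MulChar.IsQuadratic χ) (hodd : χ.Odd) :
    ∃ c : ℂ, ‖c‖ = √q ∧ ∀ k, ZMod.dft (χ : ZMod q → ℂ) k = c * χ k := by
  have h1 : ∀ k, ZMod.dft (χ : ZMod q → ℂ) k = (-gaussSum χ ZMod.stdAddChar) * χ k := by
    intro k
    rw [hprim.fourierTransform_eq_inv_mul_gaussSum, hquad.inv, hodd.eval_neg]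
    ring
  refine ⟨_, ?_, h1⟩
  have h2 := congr_fun (ZMod.dft_dft (χ : ZMod q → ℂ)) 1
  have h3 : ZMod.dft (χ : ZMod q → ℂ) = fun k => (-gaussSum χ ZMod.stdAddChar) * χ k := funext h1
  rw [h3, ZMod.dft_const_mul] at h2
  beta_reduce at h2
  rw [h1] at h2
  simp only [map_one, mul_one, smul_eq_mul, hodd.eval_neg] at h2
  have h4 := congr_arg norm h2
  rw [norm_mul, norm_mul, norm_neg, norm_neg, norm_one, mul_one, Complex.norm_natCast] at h4
  rw [norm_neg, ← h4, Real.sqrt_mul_self (norm_nonneg _)]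

lemma val_neg_real {q : ℕ} [NeZero q] {j : ZMod q} (hj : j ≠ 0) :
    ((-j).val : ℝ) / q = 1 - (j.val : ℝ) / q := by
  have : NeZero j := ⟨hj⟩
  rw [ZMod.val_neg_of_ne_zero, Nat.cast_sub (ZMod.val_lt j).le]
  have : (q : ℝ) ≠ 0 := NeZero.ne _
  field_simp

lemma LFunction_one_norm {q : ℕ} [NeZero q] (hq : 3 ≤ q) {χ : DirichletCharacter ℂ q}
    (hprim : χ.IsPrimitive) (hquad : MulChar.IsQuadratic χ) (hodd : χ.Odd) :
    √q * ‖DirichletCharacter.LFunction χ 1‖ =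
      ‖∑ j : ZMod q, χ j * ((Real.pi * (1 / 2 - (j.val : ℝ) / q) : ℝ) : ℂ)‖ := by
  obtain ⟨c, hc, h⟩ := dft_quad hprim hquad hodd
  have : Fact (1 < q) := ⟨by omega⟩
  have hχ0 : χ 0 = 0 := χ.map_nonunit (by simp)
  have h1 := ZMod.LFunction_dft (χ : ZMod q → ℂ) (s := 1) (.inl hχ0)
  have h2 : ZMod.LFunction (ZMod.dft (χ : ZMod q → ℂ)) 1 = c * DirichletCharacter.LFunction χ 1 := by
    rw [show ZMod.dft (χ : ZMod q → ℂ) = fun k => c * χ k from funext h]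
    simp only [DirichletCharacter.LFunction, ZMod.LFunction, mul_sum, mul_assoc]
    refine sum_congr rfl fun j _ => ?_
    ring
  rw [← hc, ← norm_mul, ← h2, h1]
  have h3 : ∑ j : ZMod q, χ j * expZeta (ZMod.toAddCircle (-j)) 1 =
      -∑ j : ZMod q, χ j * expZeta (ZMod.toAddCircle j) 1 := by
    rw [← sum_neg_distrib]
    refine Fintype.sum_equiv (Equiv.neg _) _ _ fun j => ?_
    rw [Equiv.neg_apply, hodd.eval_neg]; ring
  rw [h3, norm_neg]
  have h4 : ∀ j : ZMod q, χ j * expZeta (ZMod.toAddCircle j) 1 =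
      χ j * ((-Real.log (2 * Real.sin (Real.pi * ((j.val : ℝ) / q))) : ℝ) : ℂ) +
      I * (χ j * ((Real.pi * (1 / 2 - (j.val : ℝ) / q) : ℝ) : ℂ)) := by
    intro j
    by_cases hj : j = 0
    · subst hj; simp [hχ0]
    · have hq0 : (0 : ℝ) < q := by positivity
      have hjv : 0 < j.val := Nat.pos_of_ne_zero (by simpa [ZMod.val_eq_zero] using hj)
      have hjv' : (0 : ℝ) < j.val := by exact_mod_cast hjv
      have hjq : (j.val : ℝ) < q := by exact_mod_cast ZMod.val_lt j
      rw [ZMod.toAddCircle_apply, expZeta_one' (by positivity) ((div_lt_one hq0).2 hjq)]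
      ring
  rw [sum_congr rfl fun j _ => h4 j, sum_add_distrib, ← mul_sum]
  have h5 : ∑ j : ZMod q, χ j * ((-Real.log (2 * Real.sin (Real.pi * ((j.val : ℝ) / q))) : ℝ) : ℂ) = 0 := by
    apply Function.Odd.sum_eq_zero
    intro j
    by_cases hj : j = 0
    · subst hj; simp [hχ0]
    · beta_reduce
      rw [val_neg_real hj, hodd.eval_neg, mul_sub, mul_one, Real.sin_pi_sub]; ring
  rw [h5, zero_add, norm_mul, norm_I, one_mul]

lemma sin_sum {q : ℕ} [NeZero q] {χ : DirichletCharacter ℂ q}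
    (hprim : χ.IsPrimitive) (hquad : MulChar.IsQuadratic χ) (hodd : χ.Odd) (n : ℕ) :
    ‖∑ j : ZMod q, χ j * ((Real.sin (2 * Real.pi * n * ((j.val : ℝ) / q)) : ℝ) : ℂ)‖ ≤ √q := by
  obtain ⟨c, hc, h⟩ := dft_quad hprim hquad hodd
  have hb : ∀ k, ‖ZMod.dft (χ : ZMod q → ℂ) k‖ ≤ √q := by
    intro k
    rw [h, norm_mul, hc]
    exact mul_le_of_le_one_right (Real.sqrt_nonneg _) (χ.norm_le_one k)
  have e : ∀ (j : ZMod q), ZMod.stdAddChar (j * (n : ZMod q)) =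
      cexp (((2 * Real.pi * n * ((j.val : ℝ) / q) : ℝ) : ℂ) * I) := by
    intro j
    have : j * (n : ZMod q) = ((j.val * n : ℕ) : ℤ) := by simp
    rw [this, ZMod.stdAddChar_coe]
    congr 1; push_cast; ring
  have : ∑ j : ZMod q, χ j * ((Real.sin (2 * Real.pi * n * ((j.val : ℝ) / q)) : ℝ) : ℂ) =
     (ZMod.dft (χ : ZMod q → ℂ) n - ZMod.dft (χ : ZMod q → ℂ) (-n)) * (I / 2) := by
    rw [ZMod.dft_apply, ZMod.dft_apply, ← sum_sub_distrib, sum_mul]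
    refine sum_congr rfl fun j _ => ?_
    rw [mul_neg, neg_neg, AddChar.map_neg_eq_inv, e, ← Complex.exp_neg, ofReal_sin, Complex.sin]
    simp only [smul_eq_mul, neg_mul]
    ring
  rw [this, norm_mul, norm_div, norm_I, RCLike.norm_ofNat]
  have := norm_sub_le (ZMod.dft (χ : ZMod q → ℂ) n) (ZMod.dft (χ : ZMod q → ℂ) (-n))
  have := hb n
  have := hb (-n)
  linarith

lemma zmod_sum {q : ℕ} [NeZero q] (f : ℕ → ℝ) :
    ∑ j : ZMod q, f j.val = ∑ a ∈ range q, f a := by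
  obtain ⟨m, rfl⟩ : ∃ m, q = m + 1 := ⟨q - 1, by have := NeZero.ne q; omega⟩
  exact Fin.sum_univ_eq_sum_range f (m + 1)

lemma L_bound {q : ℕ} [NeZero q] (hq : 3 ≤ q) {χ : DirichletCharacter ℂ q}
    (hprim : χ.IsPrimitive) (hquad : MulChar.IsQuadratic χ) (hodd : χ.Odd) (M : ℕ) (hM : 0 < M) :
    ‖DirichletCharacter.LFunction χ 1‖ ≤ (harmonic (2 * M) - 1) +
      √q / (Real.pi * M) * (1 / 2 + harmonic (2 * M) - 1 / 2 * harmonic M) := by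
  have hq0 : (0 : ℝ) < q := by positivity
  have hs : 0 < √(q : ℝ) := Real.sqrt_pos.2 hq0
  have : Fact (1 < q) := ⟨by omega⟩
  have hχ0 : χ 0 = 0 := χ.map_nonunit (by simp)
  set N := 2 * M with hN
  have hN0 : 0 < N := by omega
  have h1 := LFunction_one_norm hq hprim hquad hodd
  have h2 : ∑ j : ZMod q, χ j * ((Real.pi * (1 / 2 - (j.val : ℝ) / q) : ℝ) : ℂ) =
      ∑ n ∈ range N, ((1 / ((n : ℝ) + 1) - 1 / N : ℝ) : ℂ) *
        (∑ j : ZMod q, χ j * ((Real.sin (2 * Real.pi * ((n + 1 : ℕ) : ℝ) * ((j.val : ℝ) / q)) : ℝ) : ℂ)) +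
      ∑ j : ZMod q, χ j * ((dD N ((j.val : ℝ) / q) : ℝ) : ℂ) := by
    simp_rw [mul_sum]
    rw [sum_comm, ← sum_add_distrib]
    refine sum_congr rfl fun j _ => ?_
    have : Real.pi * (1 / 2 - (j.val : ℝ) / q) = ∑ n ∈ range N, (1 / ((n : ℝ) + 1) - 1 / N) *
        Real.sin (2 * Real.pi * ((n + 1 : ℕ) : ℝ) * ((j.val : ℝ) / q)) + dD N ((j.val : ℝ) / q) := by
      unfold dD; push_cast; ring
    rw [this, ofReal_add, mul_add, ofReal_sum, mul_sum]
    congr 1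
    refine sum_congr rfl fun n _ => ?_
    rw [ofReal_mul]; ring
  have h3 : ‖∑ n ∈ range N, ((1 / ((n : ℝ) + 1) - 1 / N : ℝ) : ℂ) *
        (∑ j : ZMod q, χ j * ((Real.sin (2 * Real.pi * ((n + 1 : ℕ) : ℝ) * ((j.val : ℝ) / q)) : ℝ) : ℂ))‖
      ≤ (harmonic N - 1) * √q := by
    have : (harmonic N : ℝ) - 1 = ∑ n ∈ range N, (1 / ((n : ℝ) + 1) - 1 / N) := by
      have : (N : ℝ) ≠ 0 := by positivity
      rw [sum_sub_distrib, harm, sum_const, card_range, nsmul_eq_mul]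
      field_simp
    rw [this, sum_mul]
    refine norm_sum_le_of_le _ fun n hn => ?_
    rw [norm_mul, norm_real]
    have h0 : 0 ≤ 1 / ((n : ℝ) + 1) - 1 / N := by
      rw [Finset.mem_range] at hn
      have : (n : ℝ) + 1 ≤ N := by exact_mod_cast hn
      have := one_div_le_one_div_of_le (by positivity) this
      linarith
    rw [Real.norm_of_nonneg h0]
    exact mul_le_mul_of_nonneg_left (sin_sum hprim hquad hodd (n + 1)) h0
  have h4 : ‖∑ j : ZMod q, χ j * ((dD N ((j.val : ℝ) / q) : ℝ) : ℂ)‖ ≤ 2 * q * pP N (1 / 2) := by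
    refine le_trans ?_ (dD_sum N q hN0 (by omega))
    have : ∑ a ∈ range (q - 1), |dD N (((a + 1 : ℕ) : ℝ) / q)| =
        ∑ j : ZMod q, (fun a : ℕ => if a = 0 then 0 else |dD N ((a : ℝ) / q)|) j.val := by
      rw [zmod_sum (q := q) (fun a : ℕ => if a = 0 then 0 else |dD N ((a : ℝ) / q)|)]
      obtain ⟨m, hm⟩ : ∃ m, q = m + 1 := ⟨q - 1, by omega⟩
      have : range q = range (m + 1) := by rw [hm]
      rw [this, sum_range_succ', show q - 1 = m by omega]
      simp
    rw [this]
    refine norm_sum_le_of_le _ fun j _ => ?_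
    by_cases hj : j = 0
    · subst hj; simp [hχ0]
    · have : j.val ≠ 0 := by simpa [ZMod.val_eq_zero] using hj
      simp only [this, if_false]
      rw [norm_mul, norm_real, Real.norm_eq_abs]
      exact mul_le_of_le_one_left (abs_nonneg _) (χ.norm_le_one j)
  have h5 := pP_half_le M hM
  rw [← hN] at h5
  rw [h2] at h1
  have h6 := norm_add_le_of_le h3 h4
  rw [← h1] at h6
  have h7 := mul_le_mul_of_nonneg_left h5 (by positivity : (0 : ℝ) ≤ 2 * q)
  have h8 : √(q : ℝ) * √q = q := Real.mul_self_sqrt hq0.le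
  set B := (1 / 2 + (harmonic N : ℝ) - 1 / 2 * harmonic M)
  have h9 : 2 * (q : ℝ) * (1 / (2 * Real.pi * M) * B) = √q * (√q / (Real.pi * M) * B) := by
    rw [show √(q : ℝ) * (√q / (Real.pi * M) * B) = (√q * √q) / (Real.pi * M) * B by ring, h8]
    have := Real.pi_ne_zero
    field_simp
  refine le_of_mul_le_mul_left ?_ hs
  linarith

lemma LFunction_one_real {q : ℕ} [NeZero q] {χ : DirichletCharacter ℂ q}
    (hquad : MulChar.IsQuadratic χ) (hodd : χ.Odd) :
    (DirichletCharacter.LFunction χ 1).im = 0 := by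
  have hne : χ ≠ 1 := by
    rintro rfl
    have := hodd
    rw [DirichletCharacter.Odd, MulChar.one_apply isUnit_one.neg] at this
    norm_num at this
  have hre : ∀ s : ℝ, 1 < s → (DirichletCharacter.LFunction χ s).im = 0 := by
    intro s hs
    have hs' : 1 < (s : ℂ).re := by simpa using hs
    rw [DirichletCharacter.LFunction_eq_LSeries χ hs', LSeries,
      Complex.im_tsum (ZMod.LSeriesSummable_of_one_lt_re _ hs')]
    refine (tsum_congr fun n => ?_).trans tsum_zero
    rw [LSeries.term_def]
    split_ifs
    · simp
    · have h1 : ((n : ℂ) ^ (s : ℂ)) = (((n : ℝ) ^ s : ℝ) : ℂ) := by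
        rw [ofReal_cpow (Nat.cast_nonneg n)]; simp
      rw [h1]
      rcases hquad n with h | h | h <;> rw [h]
      · simp
      · rw [← ofReal_one, ← ofReal_div, ofReal_im]
      · rw [← ofReal_one, ← ofReal_neg, ← ofReal_div, ofReal_im]
  have c : ContinuousAt (fun s : ℝ => (DirichletCharacter.LFunction χ s).im) 1 := by
    apply Complex.continuous_im.continuousAt.comp
    apply ContinuousAt.comp (g := DirichletCharacter.LFunction χ) _ continuous_ofReal.continuousAt
    exact (DirichletCharacter.differentiable_LFunction hne _).continuousAt
  have c2 := c.tendsto.mono_left (nhdsWithin_le_nhds (s := Ioi 1))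
  have := tendsto_nhds_unique c2 (tendsto_const_nhds.congr' (f₁ := fun _ => (0:ℝ)) (by
    filter_upwards [self_mem_nhdsWithin] with s hs using (hre s hs).symm))
  simpa using this

lemma final_num {q : ℕ} (hq : 3 ≤ q) : ∃ M : ℕ, 0 < M ∧
    ((harmonic (2 * M) : ℝ) - 1) +
      √q / (Real.pi * M) * (1 / 2 + harmonic (2 * M) - 1 / 2 * harmonic M) ≤
    (1 / 2 + 1 / (2 * Real.pi)) * Real.log q + 1 / Real.pi * Real.log (Real.log q) + 1 := by
  have hpi := Real.pi_gt_d2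
  have hpi2 := Real.pi_lt_d2
  have hq3 : (3 : ℝ) ≤ q := by exact_mod_cast hq
  have hinv : 1 / 3.15 < 1 / Real.pi := one_div_lt_one_div_of_lt (by positivity) hpi2
  have hinv2 : 1 / Real.pi < 1 / 3.14 := one_div_lt_one_div_of_lt (by norm_num) hpi
  have he : (1 / (2 * Real.pi)) = 1 / 2 * (1 / Real.pi) := by field_simp
  have hl2 := Real.log_two_gt_d9
  have hl2' := Real.log_two_lt_d9
  rcases Nat.lt_or_ge q 7 with h7 | h7
  · refine ⟨1, one_pos, ?_⟩
    have h3 : (1.09 : ℝ) ≤ Real.log 3 := by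
      have : Real.log (3 : ℝ) = Real.log 2 + Real.log (3 / 2) := by
        rw [← Real.log_mul] <;> norm_num
      have h32 : Real.log (2 ^ 7) ≤ Real.log ((3 / 2) ^ 12 : ℝ) := Real.log_le_log (by norm_num) (by norm_num)
      rw [Real.log_pow, Real.log_pow] at h32
      push_cast at h32
      linarith
    have hlq : Real.log 3 ≤ Real.log q := Real.log_le_log (by norm_num) hq3
    have hll : 0 ≤ Real.log (Real.log q) := Real.log_nonneg (by linarith)
    have hsq : √(q : ℝ) ≤ 2.45 := by
      apply Real.sqrt_le_iff.2
      have : (q : ℝ) ≤ 6 := by exact_mod_cast (by omega : q ≤ 6)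
      constructor <;> norm_num
      linarith
    have hh1 : (harmonic 1 : ℝ) = 1 := by simp [harmonic]
    have hh2 : (harmonic (2 * 1) : ℝ) = 3 / 2 := by simp [harmonic, Finset.sum_range_succ]; norm_num
    rw [hh1, hh2, he]
    have e1 : √(q : ℝ) / (Real.pi * (1 : ℕ)) = √q * (1 / Real.pi) := by push_cast; field_simp
    rw [e1]
    set p := 1 / Real.pi
    have hp : 0 < p := by linarith [show (0:ℝ) < 1 / 3.15 by norm_num]
    have a1 : √(q : ℝ) * p ≤ 2.45 * (1 / 3.14) := mul_le_mul hsq hinv2.le hp.le (by norm_num)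
    have a2 : (1 / 2 + 1 / 2 * (1 / 3.15)) * 1.09 ≤ (1 / 2 + 1 / 2 * p) * Real.log q :=
      mul_le_mul (by linarith) (by linarith) (by norm_num) (by linarith)
    have a3 : 0 ≤ p * Real.log (Real.log q) := by positivity
    norm_num at a1 a2 ⊢
    linarith
  · set x := √(q : ℝ) with hx
    have hq0 : (0 : ℝ) < q := by linarith
    have hx0 : 0 < x := Real.sqrt_pos.2 hq0
    have hxx : x ^ 2 = q := Real.sq_sqrt hq0.le
    have h7' : (7 : ℝ) ≤ q := by exact_mod_cast h7
    have hx7 : 2.645 ≤ x := by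
      apply Real.le_sqrt_of_sq_le; norm_num; linarith
    set M := ⌈x / 2⌉₊ with hMdef
    have hM1 : x / 2 ≤ M := Nat.le_ceil _
    have hM2 : (M : ℝ) < x / 2 + 1 := Nat.ceil_lt_add_one (by positivity)
    have hM : 2 ≤ M := by
      have : (1 : ℝ) < M := by linarith
      exact_mod_cast this
    have hMr : (2 : ℝ) ≤ M := by exact_mod_cast hM
    refine ⟨M, by omega, ?_⟩
    have hratio : 2 * (M : ℝ) ≤ 1.513 * x := by
      rcases hM.eq_or_lt with h | h
      · rw [← h]; push_cast; linarith
      · have : (3 : ℝ) ≤ M := by exact_mod_cast h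
        linarith
    have hlogq : Real.log q = 2 * Real.log x := by rw [← hxx, Real.log_pow]; push_cast; rfl
    have hl15 : Real.log 1.513 ≤ 0.4145 := by
      have h1 : Real.log (1.513 ^ 10 : ℝ) ≤ Real.log (2 ^ 6 * (1 - 0.0176)) := Real.log_le_log (by norm_num) (by norm_num)
      rw [Real.log_mul (by norm_num) (by norm_num), Real.log_pow, Real.log_pow] at h1
      have := Real.log_le_sub_one_of_pos (by norm_num : (0:ℝ) < 1 - 0.0176)
      push_cast at h1
      linarith
    have hu : Real.log (2 * M) ≤ Real.log x + 0.4145 := by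
      have : Real.log (2 * (M : ℝ)) ≤ Real.log (1.513 * x) := Real.log_le_log (by positivity) hratio
      rw [Real.log_mul (by norm_num) hx0.ne'] at this
      linarith
    have hM0 : M ≠ 0 := by omega
    have hH2 : (harmonic (2 * M) : ℝ) ≤ Real.log (2 * M) + 0.6972 := by
      have := Real.strictAnti_eulerMascheroniSeq'.antitone (show 4 ≤ 2 * M by omega)
      simp only [Real.eulerMascheroniSeq', show 2 * M ≠ 0 by omega, if_false] at this
      have h4 : (harmonic 4 : ℝ) = 25 / 12 := by simp [harmonic, Finset.sum_range_succ]; norm_num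
      have hl4 : Real.log ((4 : ℕ) : ℝ) = 2 * Real.log 2 := by
        rw [show ((4 : ℕ) : ℝ) = 2 ^ 2 by norm_num, Real.log_pow]; push_cast; rfl
      rw [h4, hl4] at this
      norm_num at this ⊢
      linarith
    have hH1 : Real.log M + 1 / 2 ≤ harmonic M := by
      have a := Real.eulerMascheroniConstant_lt_eulerMascheroniSeq' M
      have b := Real.one_half_lt_eulerMascheroniConstant
      simp only [Real.eulerMascheroniSeq', hM0, if_false] at a
      linarith
    have hlM : Real.log (2 * (M : ℝ)) = Real.log 2 + Real.log M := Real.log_mul (by norm_num) (by positivity)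
    have hll : 0.6 ≤ Real.log (Real.log q) := by
      have hlq : 1.9 ≤ Real.log q := by
        have h1 : Real.log (7 : ℝ) ≤ Real.log q := Real.log_le_log (by norm_num) h7'
        have h2 : Real.log (2 ^ 14) ≤ Real.log ((7 : ℝ) ^ 5) := Real.log_le_log (by norm_num) (by norm_num)
        rw [Real.log_pow, Real.log_pow] at h2
        push_cast at h2
        linarith
      have h3 : Real.log 1.9 ≤ Real.log (Real.log q) := Real.log_le_log (by norm_num) hlq
      have h4 : Real.log (2 ^ 9) ≤ Real.log (1.9 ^ 10 : ℝ) := Real.log_le_log (by norm_num) (by norm_num)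
      rw [Real.log_pow, Real.log_pow] at h4
      push_cast at h4
      linarith
    rw [he, hlogq]
    rw [hlogq] at hll
    have e1 : x / (Real.pi * M) = (x / M) * (1 / Real.pi) := by field_simp
    rw [e1]
    set p := 1 / Real.pi
    have hp : 0 < p := by linarith [show (0:ℝ) < 1 / 3.15 by norm_num]
    have hxM : x / M ≤ 2 := by rw [div_le_iff₀ (by positivity)]; linarith
    have hxM0 : 0 < x / M := by positivity
    set LL := Real.log (2 * Real.log x)
    set u := Real.log (2 * (M : ℝ))
    set X := Real.log x
    have hB : 1 / 2 + (harmonic (2 * M) : ℝ) - 1 / 2 * harmonic M ≤ 1 / 2 * X + 1.5012 := by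
      linarith
    have hX : 0 ≤ X := Real.log_nonneg (by linarith)
    have t1 : x / M * p * (1 / 2 + (harmonic (2 * M) : ℝ) - 1 / 2 * harmonic M) ≤
        2 * p * (1 / 2 * X + 1.5012) := by
      calc _ ≤ x / M * p * (1 / 2 * X + 1.5012) := mul_le_mul_of_nonneg_left hB (by positivity)
        _ ≤ _ := by gcongr
    have t2 : p * 0.6 ≤ p * LL := mul_le_mul_of_nonneg_left hll hp.le
    norm_num at hinv hinv2
    nlinarith


end Helpers

/-- For a negative fundamental discriminant `d` with `|d| ≥ 3` and the associated odd primitive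
real (quadratic) Dirichlet character `χ` mod `|d|` (the Kronecker symbol),
`L(1, χ) ≤ (1/2 + 1/(2π)) ln|d| + (1/π) ln ln|d| + 1`. -/
theorem stmt_7 (d : ℤ) (hd : d < 0) (hd3 : 3 ≤ |d|) [NeZero d.natAbs]
    (hfund : ∃ (K : Type) (_ : Field K) (_ : NumberField K),
      Module.finrank ℚ K = 2 ∧ NumberField.discr K = d)
    (χ : DirichletCharacter ℂ d.natAbs)
    (hprim : χ.IsPrimitive) (hquad : MulChar.IsQuadratic χ) (hodd : χ.Odd) :
    ∃ L : ℝ, DirichletCharacter.LFunction χ 1 = (L : ℂ) ∧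
      L ≤ (1 / 2 + 1 / (2 * Real.pi)) * Real.log |(d : ℝ)|
        + 1 / Real.pi * Real.log (Real.log |(d : ℝ)|) + 1 := by
  have hq : 3 ≤ d.natAbs := by
    rw [Int.abs_eq_natAbs] at hd3
    exact_mod_cast hd3
  have habs : |(d : ℝ)| = ((d.natAbs : ℕ) : ℝ) := by rw [Nat.cast_natAbs, Int.cast_abs]
  obtain ⟨M, hM, hnum⟩ := final_num hq
  refine ⟨(DirichletCharacter.LFunction χ 1).re,
    Complex.ext (by simp) (by simpa using LFunction_one_real hquad hodd), ?_⟩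
  rw [habs]
  exact ((Complex.re_le_norm _).trans (L_bound hq hprim hquad hodd M hM)).trans hnum
end

section
/- Let p be a prime, let d be a negative fundamental discriminant with 3 ≤ |d| ≤ 4p, and let h(d) be the class number of the imaginary quadratic field of discriminant d. Then h(d) ≤ ((1+π)/π²) √p ln(4p) + (2/π²) √p ln ln(4p) + (2/π) √p. -/
section Helpers

open NumberField nonZeroDivisors

lemma quad_basis (K : Type) [Field K] [NumberField K] (hrank : Module.finrank ℚ K = 2) :
    ∃ (w : 𝓞 K) (t n : ℤ), w ^ 2 = t * w - n ∧ t ^ 2 - 4 * n = NumberField.discr K ∧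
      (∀ z : 𝓞 K, ∃ x y : ℤ, z = x + y * w) ∧
      (∀ x y : ℤ, (x : 𝓞 K) + y * w = 0 → x = 0 ∧ y = 0) ∧
      (∀ x y : ℤ, Algebra.norm ℤ ((x : 𝓞 K) + y * w) = x ^ 2 + t * x * y + n * y ^ 2) := by
  have hr : Module.finrank ℤ (𝓞 K) = 2 := by rw [RingOfIntegers.rank, hrank]
  let e : Module.Basis (Fin 2) ℤ (𝓞 K) := Module.finBasisOfFinrankEq ℤ (𝓞 K) hr
  obtain ⟨x0, hx0⟩ : ∃ x0, x0 = e.repr 1 0 := ⟨_, rfl⟩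
  obtain ⟨y0, hy0⟩ : ∃ y0, y0 = e.repr 1 1 := ⟨_, rfl⟩
  have h1 : (1 : 𝓞 K) = x0 • e 0 + y0 • e 1 := by
    rw [hx0, hy0]; simpa [Fin.sum_univ_two] using (e.sum_repr 1).symm
  have hcop : IsCoprime x0 y0 := by
    rw [Int.isCoprime_iff_gcd_eq_one]
    obtain ⟨u, hu⟩ := Int.gcd_dvd_left x0 y0
    obtain ⟨v, hv⟩ := Int.gcd_dvd_right x0 y0
    set g : ℕ := Int.gcd x0 y0
    have h2 : (1 : 𝓞 K) = (g : ℤ) • (u • e 0 + v • e 1) := by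
      rw [smul_add, smul_smul, smul_smul, ← hu, ← hv]; exact h1
    have h3 : e.repr 1 = (g : ℤ) • e.repr (u • e 0 + v • e 1) := by
      rw [← map_smul, ← h2]
    have h4 : Algebra.norm ℤ (1 : 𝓞 K) = (g : ℤ) ^ 2 * Algebra.norm ℤ (u • e 0 + v • e 1) := by
      conv_lhs => rw [h2]
      rw [Algebra.smul_def, map_mul, Algebra.norm_algebraMap_of_basis e]
      simp
    rw [map_one] at h4
    have h5 : (g : ℤ) ∣ 1 := by
      rw [h4, pow_two, mul_assoc]; exact dvd_mul_right _ _
    have := Int.isUnit_iff.1 (isUnit_of_dvd_one h5)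
    omega
  obtain ⟨u, v, huv⟩ := hcop
  obtain ⟨w, hw⟩ : ∃ w : 𝓞 K, w = (-v) • e 0 + u • e 1 := ⟨_, rfl⟩
  have he0 : e 0 = u • (1 : 𝓞 K) - y0 • w := by
    rw [h1, hw]
    have : e 0 = (u * x0 + v * y0) • e 0 := by rw [huv, one_smul]
    conv_lhs => rw [this]
    simp only [zsmul_eq_mul]; push_cast; ring
  have he1 : e 1 = v • (1 : 𝓞 K) + x0 • w := by
    rw [h1, hw]
    have : e 1 = (u * x0 + v * y0) • e 1 := by rw [huv, one_smul]
    conv_lhs => rw [this]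
    simp only [zsmul_eq_mul]; push_cast; ring
  have hspan : ∀ z : 𝓞 K, ∃ x y : ℤ, z = x + y * w := by
    intro z
    have := e.sum_repr z
    rw [Fin.sum_univ_two, he0, he1] at this
    refine ⟨e.repr z 0 * u + e.repr z 1 * v, - e.repr z 0 * y0 + e.repr z 1 * x0, ?_⟩
    conv_lhs => rw [← this]
    simp only [zsmul_eq_mul]; push_cast; ring
  have hli : ∀ x y : ℤ, (x : 𝓞 K) + y * w = 0 → x = 0 ∧ y = 0 := by
    intro x y hxy
    have h2 : (x * x0 - y * v) • e 0 + (x * y0 + y * u) • e 1 = 0 := by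
      rw [← hxy]
      have : (x : 𝓞 K) = x * (x0 • e 0 + y0 • e 1) := by rw [← h1, mul_one]
      rw [this, hw]
      simp only [zsmul_eq_mul]; push_cast; ring
    have hl := Fintype.linearIndependent_iff.1 e.linearIndependent
      ![x * x0 - y * v, x * y0 + y * u] (by simpa [Fin.sum_univ_two] using h2)
    have ha := hl 0
    have hb := hl 1
    simp at ha hb
    constructor
    · linear_combination u * ha + v * hb - x * huv
    · linear_combination - y0 * ha + x0 * hb - y * huv
  let b : Module.Basis (Fin 2) ℤ (𝓞 K) := Module.Basis.mk (v := ![(1 : 𝓞 K), w])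
    (by
      rw [Fintype.linearIndependent_iff]
      intro g hg
      have := hli (g 0) (g 1) (by simpa [Fin.sum_univ_two] using hg)
      intro i; fin_cases i
      · exact this.1
      · exact this.2)
    (by
      rintro z -
      obtain ⟨x, y, rfl⟩ := hspan z
      have h1 : (1 : 𝓞 K) ∈ Submodule.span ℤ (Set.range ![(1 : 𝓞 K), w]) :=
        Submodule.subset_span ⟨0, rfl⟩
      have h2 : w ∈ Submodule.span ℤ (Set.range ![(1 : 𝓞 K), w]) :=
        Submodule.subset_span ⟨1, rfl⟩
      have := add_mem (Submodule.smul_mem _ x h1) (Submodule.smul_mem _ y h2)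
      simpa using this)
  have hb0 : b 0 = 1 := by simp [b]
  have hb1 : b 1 = w := by simp [b]
  obtain ⟨n', t, hnt⟩ := hspan (w ^ 2)
  have hmul : w ^ 2 = t * w - ((-n' : ℤ) : 𝓞 K) := by rw [hnt]; push_cast; ring
  obtain ⟨n, hn⟩ : ∃ n, n = -n' := ⟨_, rfl⟩
  rw [← hn] at hmul
  have hrepr : ∀ x y : ℤ, b.repr ((x : 𝓞 K) + y * w) = Finsupp.single 0 x + Finsupp.single 1 y := by
    intro x y
    apply b.repr.symm.injective
    simp [hb0, hb1]
  have hmat : ∀ x y : ℤ, Algebra.leftMulMatrix b ((x : 𝓞 K) + y * w) =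
      !![x, - n * y; y, x + t * y] := by
    intro x y
    have c0 : ((x : 𝓞 K) + y * w) * b 0 = (x : 𝓞 K) + y * w := by rw [hb0, mul_one]
    have c1 : ((x : 𝓞 K) + y * w) * b 1 = ((- n * y : ℤ) : 𝓞 K) + ((x + t * y : ℤ) : 𝓞 K) * w := by
      rw [hb1]; push_cast; linear_combination (y : 𝓞 K) * hmul
    ext i j
    rw [Algebra.leftMulMatrix_eq_repr_mul]
    fin_cases j
    · simp only [Fin.zero_eta, c0, hrepr]
      fin_cases i <;> simp
    · simp only [Fin.mk_one, c1, hrepr]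
      fin_cases i <;> simp
  have htr : ∀ x y : ℤ, Algebra.trace ℤ (𝓞 K) ((x : 𝓞 K) + y * w) = 2 * x + t * y := by
    intro x y
    rw [Algebra.trace_eq_matrix_trace b, hmat, Matrix.trace_fin_two]
    simp; ring
  refine ⟨w, t, n, hmul, ?_, hspan, hli, ?_⟩
  · rw [← NumberField.discr_eq_discr K b, Algebra.discr_def, Matrix.det_fin_two]
    simp only [Algebra.traceMatrix_apply, Algebra.traceForm_apply, hb0, hb1]
    have q0 := htr 1 0
    have q1 := htr 0 1
    have q2 := htr (-n) t
    have : ((-n : ℤ) : 𝓞 K) + t * w = w * w := by push_cast; linear_combination - hmul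
    rw [this] at q2
    simp at q0 q1
    simp only [one_mul, mul_one, q1, q2]
    rw [q0]
    ring
  · intro x y
    rw [Algebra.norm_eq_matrix_det b, hmat, Matrix.det_fin_two]
    simp; ring

lemma quad_max (K : Type) [Field K] [NumberField K] (w : 𝓞 K) (t n : ℤ)
    (hw : w ^ 2 = t * w - n) (hspan : ∀ z : 𝓞 K, ∃ x y : ℤ, z = x + y * w)
    (hli : ∀ x y : ℤ, (x : 𝓞 K) + y * w = 0 → x = 0 ∧ y = 0)
    (p : ℕ) (hp : p.Prime) (x : ℤ) (h1 : (p : ℤ) ∣ 2 * x - t)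
    (h2 : (p : ℤ) ^ 2 ∣ x ^ 2 - t * x + n) : False := by
  obtain ⟨r, hr⟩ := h1
  obtain ⟨s, hs⟩ := h2
  have hp0 : (p : K) ≠ 0 := by exact_mod_cast hp.ne_zero
  have hwK : (w : K) ^ 2 = t * (w : K) - n := by
    have := congrArg (fun z : 𝓞 K => (z : K)) hw
    simpa using this
  have hrK : (2 : K) * x - t = p * r := by exact_mod_cast congrArg (Int.cast : ℤ → K) hr
  have hsK : (x : K) ^ 2 - t * x + n = p ^ 2 * s := by
    exact_mod_cast congrArg (Int.cast : ℤ → K) hs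
  have hint : IsIntegral ℤ (((w : K) - x) / p) := by
    refine ⟨Polynomial.X ^ 2 + Polynomial.C r * Polynomial.X + Polynomial.C s, by monicity!, ?_⟩
    simp only [Polynomial.eval₂_add, Polynomial.eval₂_mul, Polynomial.eval₂_pow,
      Polynomial.eval₂_X, Polynomial.eval₂_C]
    simp only [eq_intCast]
    field_simp
    linear_combination hwK - ((w : K) - x) * hrK - hsK
  obtain ⟨z, hz⟩ : ∃ z : 𝓞 K, (z : K) = ((w : K) - x) / p := ⟨⟨_, hint⟩, rfl⟩
  have hz2 : (p : 𝓞 K) * z = w - x := by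
    apply RingOfIntegers.ext
    have : ((p : 𝓞 K) * z : 𝓞 K) = (p : K) * (z : K) := by simp
    rw [this, hz]
    simp; field_simp
  obtain ⟨u, v, rfl⟩ := hspan z
  have := (hli (p * u + x) (p * v - 1) (by push_cast; linear_combination hz2)).2
  have h5 : (p : ℤ) ∣ 1 := ⟨v, by linarith⟩
  have := Int.isUnit_iff.1 (isUnit_of_dvd_one h5)
  have := hp.two_le
  omega

/-- roots of `X^2 - tX + n` modulo `a` -/
abbrev QRoot (t n : ℤ) (a : ℕ) : Type := {x : ZMod a // x ^ 2 - t * x + n = 0}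

lemma qroot_mul (t n : ℤ) (a b : ℕ) (ha : 0 < a) (hb : 0 < b) (hab : a.Coprime b) :
    Nat.card (QRoot t n (a * b)) ≤ Nat.card (QRoot t n a) * Nat.card (QRoot t n b) := by
  have : NeZero a := ⟨ha.ne'⟩
  have : NeZero b := ⟨hb.ne'⟩
  rw [← Nat.card_prod]
  let e := ZMod.chineseRemainder hab
  have h : ∀ x : QRoot t n (a * b), (e x.1) ^ 2 - t * e x.1 + n = 0 := by
    intro x
    have := congrArg e x.2
    simpa only [map_add, map_sub, map_pow, map_mul, map_intCast, map_zero] using this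
  refine Nat.card_le_card_of_injective
    (fun x => (⟨⟨(e x.1).1, ?_⟩, ⟨(e x.1).2, ?_⟩⟩ : QRoot t n a × QRoot t n b)) ?_
  · simpa using congrArg Prod.fst (h x)
  · simpa using congrArg Prod.snd (h x)
  · intro x y hxy
    simp only [Prod.mk.injEq, Subtype.mk.injEq] at hxy
    exact Subtype.ext (e.injective (Prod.ext hxy.1 hxy.2))

lemma qroot_prime (t n : ℤ) (p : ℕ) (hp : p.Prime) : Nat.card (QRoot t n p) ≤ 2 := by
  have : Fact p.Prime := ⟨hp⟩
  by_contra! hlt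
  have hlt' : 2 < Fintype.card (QRoot t n p) := by rwa [Nat.card_eq_fintype_card] at hlt
  obtain ⟨x, y, z, hxy, hxz, hyz⟩ := Fintype.two_lt_card_iff.1 hlt'
  have hx := x.2
  have hy := y.2
  have hz := z.2
  have h1 : (x.1 - y.1) * (x.1 + y.1 - t) = 0 := by linear_combination hx - hy
  have h2 : (x.1 - z.1) * (x.1 + z.1 - t) = 0 := by linear_combination hx - hz
  have h3 := (mul_eq_zero.1 h1).resolve_left (fun h => hxy (Subtype.ext (sub_eq_zero.1 h)))
  have h4 := (mul_eq_zero.1 h2).resolve_left (fun h => hxz (Subtype.ext (sub_eq_zero.1 h)))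
  exact hyz (Subtype.ext (by linear_combination h3 - h4))

lemma qroot_prime_pow (t n : ℤ) (p k : ℕ) (hp : p.Prime) (hk : 0 < k)
    (hmax : ∀ x : ℤ, (p : ℤ) ∣ 2 * x - t → (p : ℤ) ^ 2 ∣ x ^ 2 - t * x + n → False) :
    Nat.card (QRoot t n (p ^ k)) ≤ 2 := by
  have : Fact p.Prime := ⟨hp⟩
  rcases Nat.lt_or_ge 1 k with hk1 | hk1
  swap
  · obtain rfl : k = 1 := by omega
    rw [pow_one]; exact qroot_prime t n p hp
  refine le_trans ?_ (qroot_prime t n p hp)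
  have hdvd : p ∣ p ^ k := dvd_pow_self p hk.ne'
  let φ : ZMod (p ^ k) →+* ZMod p := ZMod.castHom hdvd (ZMod p)
  refine Nat.card_le_card_of_injective (fun x => (⟨φ x.1, ?_⟩ : QRoot t n p)) ?_
  · have := congrArg φ x.2
    simpa only [map_add, map_sub, map_pow, map_mul, map_intCast, map_zero] using this
  · rintro ⟨x, hx⟩ ⟨y, hy⟩ hxy
    simp only [Subtype.mk.injEq] at hxy
    obtain ⟨x, rfl⟩ := ZMod.intCast_surjective x
    obtain ⟨y, rfl⟩ := ZMod.intCast_surjective y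
    rw [map_intCast, map_intCast] at hxy
    have hxy' : (p : ℤ) ∣ x - y := by
      rw [← ZMod.intCast_zmod_eq_zero_iff_dvd]; push_cast; rw [hxy, sub_self]
    have hx' : ((p ^ k : ℕ) : ℤ) ∣ x ^ 2 - t * x + n := by
      rw [← ZMod.intCast_zmod_eq_zero_iff_dvd]; push_cast; exact hx
    have hy' : ((p ^ k : ℕ) : ℤ) ∣ y ^ 2 - t * y + n := by
      rw [← ZMod.intCast_zmod_eq_zero_iff_dvd]; push_cast; exact hy
    have hnd : ¬ (p : ℤ) ∣ 2 * x - t := by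
      intro h
      refine hmax x h (dvd_trans ?_ hx')
      push_cast
      exact pow_dvd_pow _ hk1
    have hnd2 : ¬ (p : ℤ) ∣ x + y - t := by
      intro h
      apply hnd
      have := dvd_add h hxy'
      rwa [show x + y - t + (x - y) = 2 * x - t by ring] at this
    have hprod : ((p : ℤ) ^ k) ∣ (x + y - t) * (x - y) := by
      have := dvd_sub hx' hy'
      push_cast at this
      rwa [show x ^ 2 - t * x + n - (y ^ 2 - t * y + n) = (x + y - t) * (x - y) by ring] at this
    have hc : IsCoprime ((p : ℤ) ^ k) (x + y - t) :=
      ((Nat.prime_iff_prime_int.1 hp).coprime_iff_not_dvd.2 hnd2).pow_left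
    have := hc.dvd_of_dvd_mul_left hprod
    apply Subtype.ext
    show ((x : ℤ) : ZMod (p ^ k)) = y
    rw [← sub_eq_zero, ← Int.cast_sub, ZMod.intCast_zmod_eq_zero_iff_dvd]
    exact_mod_cast this

lemma qroot_le (t n : ℤ)
    (hmax : ∀ p : ℕ, p.Prime → ∀ x : ℤ, (p : ℤ) ∣ 2 * x - t →
      (p : ℤ) ^ 2 ∣ x ^ 2 - t * x + n → False) (a : ℕ) :
    0 < a → Nat.card (QRoot t n a) ≤ 2 ^ a.primeFactors.card := by
  induction a using Nat.recOnPosPrimePosCoprime with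
  | prime_pow p k hp hk =>
    intro _
    rw [Nat.primeFactors_prime_pow hk.ne' hp]
    simpa using qroot_prime_pow t n p k hp hk (hmax p hp)
  | zero => intro h; omega
  | one =>
    intro _
    simp only [Nat.primeFactors_one, Finset.card_empty, pow_zero]
    exact Finite.card_le_one_iff_subsingleton.2 inferInstance
  | coprime a b ha hb hab iha ihb =>
    intro _
    rw [hab.primeFactors_mul, Finset.card_union_of_disjoint hab.disjoint_primeFactors, pow_add]
    exact (qroot_mul t n a b (by omega) (by omega) hab).trans
      (Nat.mul_le_mul (iha (by omega)) (ihb (by omega)))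

lemma two_pow_le_sqfree (a : ℕ) (ha : 0 < a) :
    2 ^ a.primeFactors.card = (a.divisors.filter Squarefree).card := by
  have h := Nat.sum_divisors_filter_squarefree (f := fun _ => (1 : ℕ)) ha.ne'
  rw [← Finset.card_eq_sum_ones, ← Finset.card_eq_sum_ones, Finset.card_powerset] at h
  rw [h]
  congr 2
  ext q
  rw [Multiset.mem_toFinset, Nat.mem_primeFactors, UniqueFactorizationMonoid.mem_normalizedFactors_iff ha.ne']
  simp [Nat.prime_iff, ha.ne']

lemma sum_two_pow_le (N : ℕ) :
    ((∑ a ∈ Finset.Icc 1 N, 2 ^ a.primeFactors.card : ℕ) : ℝ) ≤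
      N * ∑ m ∈ (Finset.Icc 1 N).filter (fun m => ¬ 4 ∣ m ∧ ¬ 9 ∣ m), (1 / m : ℝ) := by
  have h1 : (∑ a ∈ Finset.Icc 1 N, 2 ^ a.primeFactors.card : ℕ) ≤
      ∑ a ∈ Finset.Icc 1 N, ∑ m ∈ (Finset.Icc 1 N).filter (fun m => ¬ 4 ∣ m ∧ ¬ 9 ∣ m),
        if m ∣ a then 1 else 0 := by
    refine Finset.sum_le_sum fun a ha => ?_
    rw [Finset.mem_Icc] at ha
    rw [two_pow_le_sqfree a ha.1, ← Finset.sum_filter, ← Finset.card_eq_sum_ones]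
    refine Finset.card_le_card fun m hm => ?_
    simp only [Finset.mem_filter, Nat.mem_divisors, Finset.mem_Icc] at hm ⊢
    obtain ⟨⟨hma, ha0⟩, hsq⟩ := hm
    refine ⟨⟨⟨Nat.pos_of_dvd_of_pos hma ha.1, (Nat.le_of_dvd ha.1 hma).trans ha.2⟩, ?_, ?_⟩, hma⟩
    · intro h; have := hsq 2 h; simp at this
    · intro h; have := hsq 3 h; simp at this
  rw [Finset.sum_comm] at h1
  refine (Nat.cast_le.2 h1).trans ?_
  push_cast
  rw [Finset.mul_sum]
  refine Finset.sum_le_sum fun m hm => ?_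
  have hc : ((Finset.Icc 1 N).filter (fun a => m ∣ a)).card = N / m := by
    rw [← Nat.Ioc_filter_dvd_card_eq_div]; rfl
  rw [← Finset.sum_filter, Finset.sum_const, hc, nsmul_eq_mul, mul_one, mul_one_div]
  exact Nat.cast_div_le

lemma class_div {K : Type} [Field K] [NumberField K] (I : (Ideal (𝓞 K))⁰) (β γ : 𝓞 K)
    (hβ : β ≠ 0) (hγ : γ ≠ 0) (h : ∀ z ∈ (I : Ideal (𝓞 K)), γ ∣ β * z) :
    ∃ J : (Ideal (𝓞 K))⁰, ClassGroup.mk0 J = ClassGroup.mk0 I ∧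
      (Algebra.norm ℤ γ).natAbs * Ideal.absNorm (J : Ideal (𝓞 K)) =
        (Algebra.norm ℤ β).natAbs * Ideal.absNorm (I : Ideal (𝓞 K)) := by
  have hle : Ideal.span {β} * (I : Ideal (𝓞 K)) ≤ Ideal.span {γ} := by
    rw [Ideal.span_singleton_mul_le_iff]
    intro z hz
    exact Ideal.mem_span_singleton.2 (h z hz)
  obtain ⟨J, hJ⟩ := Ideal.dvd_iff_le.2 hle
  have hJ0 : J ≠ 0 := by
    rintro rfl
    rw [mul_zero] at hJ
    rcases mul_eq_zero.1 hJ with h | h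
    · exact hβ (Ideal.span_singleton_eq_bot.1 h)
    · exact nonZeroDivisors.coe_ne_zero I h
  refine ⟨⟨J, mem_nonZeroDivisors_of_ne_zero hJ0⟩, ?_, ?_⟩
  · rw [ClassGroup.mk0_eq_mk0_iff]
    exact ⟨γ, β, hγ, hβ, hJ.symm⟩
  · have := congrArg Ideal.absNorm hJ
    rw [map_mul, map_mul, Ideal.absNorm_span_singleton, Ideal.absNorm_span_singleton] at this
    exact this.symm

lemma class_repr (K : Type) [Field K] [NumberField K] (w : 𝓞 K) (t n : ℤ)
    (hw : w ^ 2 = t * w - n) (hspan : ∀ z : 𝓞 K, ∃ x y : ℤ, z = x + y * w)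
    (hli : ∀ x y : ℤ, (x : 𝓞 K) + y * w = 0 → x = 0 ∧ y = 0)
    (hN : ∀ x y : ℤ, Algebra.norm ℤ ((x : 𝓞 K) + y * w) = x ^ 2 + t * x * y + n * y ^ 2)
    (hd : t ^ 2 - 4 * n < 0) (C : ClassGroup (𝓞 K)) :
    ∃ a : ℕ, 0 < a ∧ 3 * (a : ℤ) ^ 2 ≤ 4 * n - t ^ 2 ∧ ∃ f : 𝓞 K →+* ZMod a,
      ∃ I : (Ideal (𝓞 K))⁰, ClassGroup.mk0 I = C ∧ RingHom.ker f = (I : Ideal (𝓞 K)) := by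
  obtain ⟨I, hIC, hmin⟩ : ∃ I : (Ideal (𝓞 K))⁰, ClassGroup.mk0 I = C ∧
      ∀ J : (Ideal (𝓞 K))⁰, ClassGroup.mk0 J = C →
        Ideal.absNorm (I : Ideal (𝓞 K)) ≤ Ideal.absNorm (J : Ideal (𝓞 K)) := by
    obtain ⟨I0, hI0⟩ := ClassGroup.mk0_surjective C
    obtain ⟨I, h1, h2⟩ := WellFounded.has_min
      (measure (fun I : (Ideal (𝓞 K))⁰ => Ideal.absNorm (I : Ideal (𝓞 K)))).wf
      {I | ClassGroup.mk0 I = C} ⟨I0, hI0⟩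
    exact ⟨I, h1, fun J hJ => not_lt.1 (h2 J hJ)⟩
  have hNpos : 0 < Ideal.absNorm (I : Ideal (𝓞 K)) := Ideal.absNorm_pos_of_nonZeroDivisors I
  -- the ideal is primitive
  obtain ⟨b0, hb0⟩ : ∃ b0 : ℤ, (b0 : 𝓞 K) + w ∈ (I : Ideal (𝓞 K)) := by
    let H : Ideal ℤ :=
      { carrier := {y | ∃ x : ℤ, (x : 𝓞 K) + y * w ∈ (I : Ideal (𝓞 K))}
        zero_mem' := ⟨0, by simp⟩
        add_mem' := by
          rintro y1 y2 ⟨x1, h1⟩ ⟨x2, h2⟩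
          refine ⟨x1 + x2, ?_⟩
          have := add_mem h1 h2
          convert! this using 1
          push_cast; ring
        smul_mem' := by
          rintro c y ⟨x, h⟩
          refine ⟨c * x, ?_⟩
          have := Ideal.mul_mem_left _ (c : 𝓞 K) h
          convert! this using 1
          push_cast [smul_eq_mul]; ring }
    suffices (1 : ℤ) ∈ H by
      obtain ⟨x, hx⟩ := this
      exact ⟨x, by simpa using hx⟩
    rw [← Ideal.eq_top_iff_one]
    by_contra hH
    obtain ⟨g, hg⟩ : ∃ g, H = Ideal.span {g} := 
      ⟨_, (Ideal.span_singleton_generator H).symm⟩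
    have hgu : g.natAbs ≠ 1 := by
      intro h
      apply hH
      rw [hg, Ideal.span_singleton_eq_top]
      exact Int.isUnit_iff_natAbs_eq.2 h
    obtain ⟨q, hq, hqg⟩ := Nat.exists_prime_and_dvd hgu
    have hqg' : (q : ℤ) ∣ g := Int.natCast_dvd.2 hqg
    have hqy : ∀ x y : ℤ, (x : 𝓞 K) + y * w ∈ (I : Ideal (𝓞 K)) → (q : ℤ) ∣ y := by
      intro x y h
      have : y ∈ H := ⟨x, h⟩
      rw [hg, Ideal.mem_span_singleton] at this
      exact hqg'.trans this
    have hq0 : (q : 𝓞 K) ≠ 0 := by exact_mod_cast hq.ne_zero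
    obtain ⟨J, hJ, hJN⟩ := class_div I 1 (q : 𝓞 K) one_ne_zero hq0 (by
      intro z hz
      obtain ⟨x, y, rfl⟩ := hspan z
      obtain ⟨y', hy'⟩ := hqy x y hz
      have h2 := hqy (-n * y) (x + t * y) (by
        have := Ideal.mul_mem_left _ w hz
        convert! this using 1
        push_cast; linear_combination - (y : 𝓞 K) * hw)
      have h3 : (q : ℤ) ∣ x := by
        have : (q : ℤ) ∣ t * y := ⟨t * y', by rw [hy']; ring⟩
        exact (dvd_add_left this).1 h2
      obtain ⟨x', hx'⟩ := h3
      refine ⟨x' + y' * w, ?_⟩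
      rw [hx', hy']; push_cast; ring)
    have hle := hmin J (hJ.trans hIC)
    have hqn : Algebra.norm ℤ (q : 𝓞 K) = (q : ℤ) ^ 2 := by
      have := hN q 0
      simpa using this
    rw [hqn, map_one] at hJN
    simp only [Int.natAbs_pow, Int.natAbs_natCast, Int.natAbs_one, one_mul] at hJN
    have h4 : 2 ^ 2 ≤ q ^ 2 := Nat.pow_le_pow_left hq.two_le 2
    have h5 := Nat.mul_le_mul_right (Ideal.absNorm (J : Ideal (𝓞 K))) h4
    omega
  -- the quotient is cyclic
  let c := ringChar (𝓞 K ⧸ (I : Ideal (𝓞 K)))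
  let ψ : ZMod c →+* 𝓞 K ⧸ (I : Ideal (𝓞 K)) := ZMod.castHom (dvd_refl c) _
  have hψ : Function.Bijective ψ := by
    refine ⟨ZMod.castHom_injective _, ?_⟩
    intro z
    obtain ⟨z, rfl⟩ := Ideal.Quotient.mk_surjective z
    obtain ⟨x, y, rfl⟩ := hspan z
    refine ⟨((x - y * b0 : ℤ) : ZMod c), ?_⟩
    rw [map_intCast, ← map_intCast (Ideal.Quotient.mk (I : Ideal (𝓞 K))), Ideal.Quotient.eq]
    have := Ideal.mul_mem_left _ (-y : 𝓞 K) hb0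
    convert! this using 1
    push_cast; ring
  have hcard : Ideal.absNorm (I : Ideal (𝓞 K)) = c := by
    rw [Ideal.absNorm_apply, Submodule.cardQuot_apply]
    rw [← Nat.card_zmod c]
    exact (Nat.card_eq_of_bijective ψ hψ).symm
  obtain ⟨a, ha⟩ : ∃ a, a = c := ⟨_, rfl⟩
  have hmemI : ∀ k : ℤ, (k : 𝓞 K) ∈ (I : Ideal (𝓞 K)) → (c : ℤ) ∣ k := by
    intro k hk
    rw [← Ideal.Quotient.eq_zero_iff_mem, map_intCast] at hk
    exact (CharP.intCast_eq_zero_iff _ c k).1 hk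
  have hcI : (c : 𝓞 K) ∈ (I : Ideal (𝓞 K)) := by
    rw [← hcard]; exact Ideal.absNorm_mem _
  have hc : 0 < c := by rw [← hcard]; exact hNpos
  let e := RingEquiv.ofBijective ψ hψ
  refine ⟨c, hc, ?_, (e.symm : _ →+* ZMod c).comp (Ideal.Quotient.mk (I : Ideal (𝓞 K))), I, hIC, ?_⟩
  swap
  · ext z
    simp [RingHom.mem_ker, Ideal.Quotient.eq_zero_iff_mem]
  obtain ⟨b, hbI, hb1, hb2⟩ : ∃ b : ℤ, (b : 𝓞 K) + w ∈ (I : Ideal (𝓞 K)) ∧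
      -(c : ℤ) ≤ 2 * b + t ∧ 2 * b + t ≤ c := by
    refine ⟨b0 - c * ((2 * b0 + t + c) / (2 * c)), ?_, ?_, ?_⟩
    · have := sub_mem hb0 (Ideal.mul_mem_left _ (((2 * b0 + t + c) / (2 * c) : ℤ) : 𝓞 K) hcI)
      convert! this using 1
      push_cast; ring
    · have h1 := Int.emod_nonneg (2 * b0 + t + c) (b := 2 * c) (by omega)
      have h2 := Int.emod_add_mul_ediv (2 * b0 + t + c) (2 * c)
      linarith
    · have h1 := Int.emod_lt_of_pos (2 * b0 + t + c) (b := 2 * c) (by omega)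
      have h2 := Int.emod_add_mul_ediv (2 * b0 + t + c) (2 * c)
      linarith
  have hprod : (((b + t : ℤ) : 𝓞 K) + ((-1 : ℤ) : 𝓞 K) * w) * (b + w) =
      ((b ^ 2 + t * b + n : ℤ) : 𝓞 K) := by
    push_cast; linear_combination - hw
  have hM : (c : ℤ) ∣ b ^ 2 + t * b + n := by
    apply hmemI
    rw [← hprod]
    exact Ideal.mul_mem_left _ _ hbI
  obtain ⟨J, hJ, hJN⟩ := class_div I (((b + t : ℤ) : 𝓞 K) + ((-1 : ℤ) : 𝓞 K) * w) (c : 𝓞 K)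
    (by intro h; have := (hli _ _ h).2; omega) (by exact_mod_cast hc.ne') (by
      intro z hz
      obtain ⟨x, y, rfl⟩ := hspan z
      have h1 : (c : ℤ) ∣ x - y * b := by
        apply hmemI
        have := sub_mem hz (Ideal.mul_mem_left _ (y : 𝓞 K) hbI)
        convert! this using 1
        push_cast; ring
      obtain ⟨u, hu⟩ := h1
      obtain ⟨v, hv⟩ := hM
      rw [hv] at hprod
      have hu' : (x : 𝓞 K) - y * b = c * u := by exact_mod_cast congrArg (Int.cast : ℤ → 𝓞 K) hu
      refine ⟨y * v + u * (((b + t : ℤ) : 𝓞 K) + ((-1 : ℤ) : 𝓞 K) * w), ?_⟩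
      push_cast at hprod ⊢
      linear_combination (y : 𝓞 K) * hprod + ((b : 𝓞 K) + t + (-1) * w) * hu')
  have hle := hmin J (hJ.trans hIC)
  have hcn : Algebra.norm ℤ (c : 𝓞 K) = (c : ℤ) ^ 2 := by
    have := hN c 0
    simpa using this
  rw [hcn, hN, hcard] at hJN
  rw [hcard] at hle
  have hJN' := congrArg (Nat.cast : ℕ → ℤ) hJN
  have hMeq : (b + t) ^ 2 + t * (b + t) * (-1) + n * (-1) ^ 2 = b ^ 2 + t * b + n := by ring
  have hMpos : 0 ≤ b ^ 2 + t * b + n := by nlinarith [sq_nonneg (2 * b + t)]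
  rw [hMeq] at hJN'
  push_cast at hJN'
  rw [abs_of_nonneg hMpos, abs_of_nonneg (sq_nonneg _)] at hJN'
  have hcZ : (0 : ℤ) < c := by exact_mod_cast hc
  have hleZ : (c : ℤ) ≤ Ideal.absNorm (J : Ideal (𝓞 K)) := by exact_mod_cast hle
  have h1 : (c : ℤ) * Ideal.absNorm (J : Ideal (𝓞 K)) = b ^ 2 + t * b + n := by
    apply mul_right_cancel₀ hcZ.ne'
    linear_combination hJN'
  have h2 : (2 * b + t) ^ 2 ≤ (c : ℤ) ^ 2 := sq_le_sq' hb1 hb2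
  nlinarith

lemma class_count (K : Type) [Field K] [NumberField K] (w : 𝓞 K) (t n : ℤ)
    (hw : w ^ 2 = t * w - n) (hspan : ∀ z : 𝓞 K, ∃ x y : ℤ, z = x + y * w)
    (hli : ∀ x y : ℤ, (x : 𝓞 K) + y * w = 0 → x = 0 ∧ y = 0)
    (hN : ∀ x y : ℤ, Algebra.norm ℤ ((x : 𝓞 K) + y * w) = x ^ 2 + t * x * y + n * y ^ 2)
    (hd : t ^ 2 - 4 * n < 0) (N : ℕ) (hbig : 4 * n - t ^ 2 < 3 * ((N : ℤ) + 1) ^ 2) :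
    classNumber K ≤ ∑ a ∈ Finset.Icc 1 N, Nat.card (QRoot t n a) := by
  classical
  choose a ha0 ha3 hf using class_repr K w t n hw hspan hli hN hd
  have haN : ∀ C, a C ∈ Finset.Icc 1 N := by
    intro C
    rw [Finset.mem_Icc]
    refine ⟨ha0 C, ?_⟩
    have h1 : (a C : ℤ) < N + 1 := by
      have := ha3 C
      by_contra! hcon
      nlinarith
    omega
  rw [classNumber, ← Finset.card_univ,
    Finset.card_eq_sum_card_fiberwise (f := a) (t := Finset.Icc 1 N) (fun C _ => haN C)]
  refine Finset.sum_le_sum fun a0 ha0' => ?_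
  rw [Finset.mem_Icc] at ha0'
  have : NeZero a0 := ⟨by omega⟩
  have hf' : ∀ C : {C // C ∈ Finset.univ.filter (fun C => a C = a0)},
      ∃ f : 𝓞 K →+* ZMod a0, ∃ I : (Ideal (𝓞 K))⁰,
        ClassGroup.mk0 I = C.1 ∧ RingHom.ker f = (I : Ideal (𝓞 K)) := by
    rintro ⟨C, hC⟩
    have : a C = a0 := by simpa using hC
    have h2 := hf C
    rw [this] at h2
    exact h2
  choose f I hI hker using hf'
  rw [← Fintype.card_coe, ← Nat.card_eq_fintype_card]
  refine Nat.card_le_card_of_injective (fun C => (⟨f C w, ?_⟩ : QRoot t n a0)) ?_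
  · have := congrArg (f C) hw
    simp only [map_sub, map_pow, map_mul, map_intCast] at this
    rw [this]; ring
  · intro C C' h
    simp only [Subtype.mk.injEq] at h
    have hff : f C = f C' := by
      ext z
      obtain ⟨x, y, rfl⟩ := hspan z
      simp [h]
    have hII : I C = I C' := Subtype.ext (by rw [← hker, ← hker, hff])
    exact Subtype.ext (by rw [← hI, ← hI, hII])

/-- partial sums of reciprocals of integers divisible neither by 4 nor by 9 -/
noncomputable def QS (N : ℕ) : ℝ :=
  ∑ i ∈ Finset.range N, if ¬ 4 ∣ (i + 1) ∧ ¬ 9 ∣ (i + 1) then (1 / ((i : ℝ) + 1)) else 0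

lemma QS_eq (N : ℕ) :
    ∑ m ∈ (Finset.Icc 1 N).filter (fun m => ¬ 4 ∣ m ∧ ¬ 9 ∣ m), (1 / m : ℝ) = QS N := by
  rw [QS, Finset.sum_filter]
  symm
  refine Finset.sum_bij (fun i _ => i + 1) ?_ ?_ ?_ ?_
  · intro i hi; simp at hi ⊢; omega
  · intro i _ j _ h; omega
  · intro m hm
    rw [Finset.mem_Icc] at hm
    exact ⟨m - 1, by simp; omega, by omega⟩
  · intro i _; push_cast; rfl

lemma QS_mono {M N : ℕ} (h : M ≤ N) : QS M ≤ QS N := by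
  refine Finset.sum_le_sum_of_subset_of_nonneg (Finset.range_mono h) ?_
  intro i _ _
  split_ifs <;> positivity

lemma pair_bound (M δ : ℝ) (hM : 54 ≤ M) (h0 : 0 ≤ δ) (h1 : δ ≤ 17) :
    1 / (M - δ) + 1 / (M + δ) ≤ (2 * 2916 / (2916 - δ ^ 2)) / M := by
  have a1 : 0 < M - δ := by linarith
  have a2 : 0 < M + δ := by linarith
  have a3 : 0 < 2916 - δ ^ 2 := by nlinarith
  have a4 : 0 < M := by linarith
  rw [div_add_div _ _ a1.ne' a2.ne', div_div, div_le_div_iff₀ (by positivity) (by positivity)]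
  have : 0 ≤ δ ^ 2 * (M ^ 2 - 2916) := mul_nonneg (sq_nonneg _) (by nlinarith)
  nlinarith

lemma QS_step (k : ℕ) (hk : 1 ≤ k) : QS (36 * (k + 1)) ≤ QS (36 * k) + 26 / (36 * k + 18) := by
  have hk' : (1 : ℝ) ≤ k := by exact_mod_cast hk
  rw [mul_add, mul_one, QS, Finset.sum_range_add, ← QS]
  have hdiv : ∀ x : ℕ, (if ¬ 4 ∣ (36 * k + x + 1) ∧ ¬ 9 ∣ (36 * k + x + 1) then
      (1 / (((36 * k + x : ℕ) : ℝ) + 1)) else 0) =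
      if ¬ 4 ∣ (x + 1) ∧ ¬ 9 ∣ (x + 1) then (1 / (36 * (k : ℝ) + (x + 1))) else 0 := by
    intro x
    have e1 : 4 ∣ (36 * k + x + 1) ↔ 4 ∣ (x + 1) := by omega
    have e2 : 9 ∣ (36 * k + x + 1) ↔ 9 ∣ (x + 1) := by omega
    simp only [e1, e2]
    push_cast
    rw [add_assoc]
  simp only [hdiv]
  gcongr
  have hM : (54 : ℝ) ≤ 36 * k + 18 := by linarith
  have p17 := pair_bound _ 17 hM (by norm_num) (by norm_num)
  have p16 := pair_bound _ 16 hM (by norm_num) (by norm_num)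
  have p15 := pair_bound _ 15 hM (by norm_num) (by norm_num)
  have p13 := pair_bound _ 13 hM (by norm_num) (by norm_num)
  have p12 := pair_bound _ 12 hM (by norm_num) (by norm_num)
  have p11 := pair_bound _ 11 hM (by norm_num) (by norm_num)
  have p8 := pair_bound _ 8 hM (by norm_num) (by norm_num)
  have p7 := pair_bound _ 7 hM (by norm_num) (by norm_num)
  have p5 := pair_bound _ 5 hM (by norm_num) (by norm_num)
  have p4 := pair_bound _ 4 hM (by norm_num) (by norm_num)
  have p3 := pair_bound _ 3 hM (by norm_num) (by norm_num)
  have p1 := pair_bound _ 1 hM (by norm_num) (by norm_num)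
  have hinv : 0 < 1 / (36 * (k : ℝ) + 18) := by positivity
  simp only [Finset.sum_range_succ, Finset.sum_range_zero]
  norm_num
  ring_nf at p17 p16 p15 p13 p12 p11 p8 p7 p5 p4 p3 p1 hinv ⊢
  linarith

lemma QS_block (k : ℕ) (hk : 1 ≤ k) :
    QS (36 * k) ≤ 0.7267 * Real.log (36 * k) + 0.66 := by
  have l2 := Real.log_two_gt_d9
  have l3 := Real.log_three_gt_d9
  induction k, hk using Nat.le_induction with
  | base =>
    have h36 : Real.log 36 = 2 * Real.log 2 + 2 * Real.log 3 := by
      rw [show (36 : ℝ) = 2 ^ 2 * 3 ^ 2 by norm_num, Real.log_mul (by norm_num) (by norm_num),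
        Real.log_pow, Real.log_pow]
      norm_num
    norm_num [QS, Finset.sum_range_succ]
    rw [h36]
    linarith
  | succ k hk ih =>
    have hk' : (1 : ℝ) ≤ k := by exact_mod_cast hk
    have h1 := QS_step k hk
    have h2 := Real.le_log_one_add_of_nonneg (x := 1 / (k : ℝ)) (by positivity)
    have h3 : Real.log (36 * ((k + 1 : ℕ) : ℝ)) = Real.log (36 * k) + Real.log (1 + 1 / k) := by
      rw [← Real.log_mul (by positivity) (by positivity)]
      congr 1
      push_cast
      field_simp
    have h4 : 2 * (1 / (k : ℝ)) / (1 / k + 2) = 36 / (36 * k + 18) := by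
      field_simp; ring
    rw [h4] at h2
    rw [h3]
    have h5 : (26 : ℝ) / (36 * k + 18) ≤ 0.7267 * (36 / (36 * k + 18)) := by
      rw [mul_div_assoc', div_le_div_iff_of_pos_right (by positivity)]
      norm_num
    linarith

lemma QS_bound (N : ℕ) (hN : 5 ≤ N) : QS N ≤ 0.7267 * Real.log N + 1.193 := by
  have l2 := Real.log_two_gt_d9
  have l2' := Real.log_two_lt_d9
  have l3 := Real.log_three_gt_d9
  have hmono : ∀ A : ℝ, 0 < A → A ≤ N → Real.log A ≤ Real.log N := fun A h1 h2 =>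
    Real.log_le_log h1 h2
  rcases lt_or_ge N 8 with h | h
  · have h1 := QS_mono (show N ≤ 7 by omega)
    have h2 := hmono 5 (by norm_num) (by exact_mod_cast hN)
    have h3 : Real.log 5 = 2 * Real.log 2 + Real.log (1 + 1 / 4) := by
      rw [show (5 : ℝ) = 2 ^ 2 * (1 + 1 / 4) by norm_num, Real.log_mul (by norm_num) (by norm_num),
        Real.log_pow]
      norm_num
    have h4 := Real.le_log_one_add_of_nonneg (x := 1 / 4) (by norm_num)
    norm_num at h4
    norm_num at h3
    have h5 : QS 7 ≤ 2.35 := by norm_num [QS, Finset.sum_range_succ]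
    linarith
  rcases lt_or_ge N 15 with h' | h'
  · have h1 := QS_mono (show N ≤ 14 by omega)
    have h2 := hmono 8 (by norm_num) (by exact_mod_cast h)
    have h3 : Real.log 8 = 3 * Real.log 2 := by
      rw [show (8 : ℝ) = 2 ^ 3 by norm_num, Real.log_pow]
      norm_num
    have h5 : QS 14 ≤ 2.69 := by norm_num [QS, Finset.sum_range_succ]
    linarith
  clear h
  rcases lt_or_ge N 23 with h | h
  · have h1 := QS_mono (show N ≤ 22 by omega)
    have h2 := hmono 12 (by norm_num) (by exact_mod_cast (by omega : 12 ≤ N))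
    have h3 : Real.log 12 = 2 * Real.log 2 + Real.log 3 := by
      rw [show (12 : ℝ) = 2 ^ 2 * 3 by norm_num, Real.log_mul (by norm_num) (by norm_num),
        Real.log_pow]
      norm_num
    have h5 : QS 22 ≤ 2.97 := by norm_num [QS, Finset.sum_range_succ]
    linarith
  clear h'
  rcases lt_or_ge N 36 with h' | h'
  · have h1 := QS_mono (show N ≤ 35 by omega)
    have h2 := hmono 18 (by norm_num) (by exact_mod_cast (by omega : 18 ≤ N))
    have h3 : Real.log 18 = Real.log 2 + 2 * Real.log 3 := by
      rw [show (18 : ℝ) = 2 * 3 ^ 2 by norm_num, Real.log_mul (by norm_num) (by norm_num),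
        Real.log_pow]
      norm_num
    have h5 : QS 35 ≤ 3.27 := by norm_num [QS, Finset.sum_range_succ]
    linarith
  clear h
  obtain ⟨k, hk1, hk2, hk3⟩ : ∃ k, 1 ≤ k ∧ 36 * k ≤ N ∧ N ≤ 36 * (k + 1) :=
    ⟨N / 36, by omega, by omega, by omega⟩
  have h1 := QS_mono hk3
  have h2 := QS_block (k + 1) (by omega)
  have hk' : (1 : ℝ) ≤ k := by exact_mod_cast hk1
  have h3 : Real.log (36 * ((k + 1 : ℕ) : ℝ)) ≤ Real.log 2 + Real.log N := by
    have hN' : (36 * k : ℝ) ≤ N := by exact_mod_cast hk2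
    rw [← Real.log_mul (by norm_num) (by positivity)]
    apply Real.log_le_log (by positivity)
    push_cast
    linarith
  linarith

lemma final_bound (N : ℕ) (hN : 1 ≤ N) (y : ℝ) (hy8 : 8 ≤ y) (hyN : 3 * (N : ℝ) ^ 2 ≤ y) :
    N * QS N ≤ Real.sqrt y * (0.2098 * Real.log y + 0.1013 * Real.log (Real.log y) + 0.3183) := by
  have l2 := Real.log_two_gt_d9
  have l3 := Real.log_three_gt_d9
  have key : ∀ (s A l : ℝ), 0 ≤ s → s ^ 2 ≤ y → 0 < A → A ≤ y → 1 ≤ l → l ≤ Real.log A →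
      s * (0.2098 * l + 0.1013 * Real.log l + 0.3183) ≤
      Real.sqrt y * (0.2098 * Real.log y + 0.1013 * Real.log (Real.log y) + 0.3183) := by
    intro s A l h1 h2 h3 h4 h5 h6
    have h7 : l ≤ Real.log y := h6.trans (Real.log_le_log h3 h4)
    have h8 : Real.log l ≤ Real.log (Real.log y) := Real.log_le_log (by linarith) h7
    have h9 : 0 ≤ Real.log l := Real.log_nonneg h5
    have h10 : s ≤ Real.sqrt y := Real.le_sqrt_of_sq_le h2
    gcongr
  rcases lt_or_ge N 5 with h | h
  · have q12 : Real.log 12 = 2 * Real.log 2 + Real.log 3 := by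
      rw [show (12 : ℝ) = 2 ^ 2 * 3 by norm_num, Real.log_mul (by norm_num) (by norm_num),
        Real.log_pow]
      norm_num
    have q8 : Real.log 8 = 3 * Real.log 2 := by
      rw [show (8 : ℝ) = 2 ^ 3 by norm_num, Real.log_pow]
      norm_num
    have q27 : Real.log 27 = 3 * Real.log 3 := by
      rw [show (27 : ℝ) = 3 ^ 3 by norm_num, Real.log_pow]
      norm_num
    have q48 : Real.log 48 = 4 * Real.log 2 + Real.log 3 := by
      rw [show (48 : ℝ) = 2 ^ 4 * 3 by norm_num, Real.log_mul (by norm_num) (by norm_num),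
        Real.log_pow]
      norm_num
    interval_cases N
    · refine le_trans ?_ (key 2.8 8 2 (by norm_num) (by linarith) (by norm_num) hy8 (by norm_num)
        (by linarith))
      norm_num [QS, Finset.sum_range_succ]
      linarith
    · norm_num at hyN
      refine le_trans ?_ (key 3.464 12 2.4 (by norm_num) (by linarith) (by norm_num) hyN
        (by norm_num) (by linarith))
      have : Real.log 2 ≤ Real.log 2.4 := Real.log_le_log (by norm_num) (by norm_num)
      have e : QS 2 = 1.5 := by norm_num [QS, Finset.sum_range_succ]
      rw [e]; push_cast
      linarith
    · norm_num at hyN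
      refine le_trans ?_ (key 5.196 27 3.29 (by norm_num) (by linarith) (by norm_num) hyN
        (by norm_num) (by linarith))
      have : Real.log 3 ≤ Real.log 3.29 := Real.log_le_log (by norm_num) (by norm_num)
      have e : QS 3 = 11 / 6 := by norm_num [QS, Finset.sum_range_succ]
      rw [e]; push_cast
      linarith
    · norm_num at hyN
      refine le_trans ?_ (key 6.928 48 3.8 (by norm_num) (by linarith) (by norm_num) hyN
        (by norm_num) (by linarith))
      have : Real.log 3 ≤ Real.log 3.8 := Real.log_le_log (by norm_num) (by norm_num)
      have e : QS 4 = 11 / 6 := by norm_num [QS, Finset.sum_range_succ]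
      rw [e]; push_cast
      linarith
  have hN5 : (5 : ℝ) ≤ N := by exact_mod_cast h
  have hlog : Real.log (3 * (N : ℝ) ^ 2) = Real.log 3 + 2 * Real.log N := by
    rw [Real.log_mul (by norm_num) (by positivity), Real.log_pow]
    norm_num
  have hL : 2 * Real.log 2 ≤ Real.log N := by
    have : Real.log (2 ^ 2) ≤ Real.log N := Real.log_le_log (by norm_num) (by linarith)
    rw [Real.log_pow] at this
    exact_mod_cast this
  have hl5 : 1.5 ≤ Real.log N := by
    have h3 : Real.log 5 = 2 * Real.log 2 + Real.log (1 + 1 / 4) := by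
      rw [show (5 : ℝ) = 2 ^ 2 * (1 + 1 / 4) by norm_num, Real.log_mul (by norm_num) (by norm_num),
        Real.log_pow]
      norm_num
    have h4 := Real.le_log_one_add_of_nonneg (x := 1 / 4) (by norm_num)
    norm_num at h4
    norm_num at h3
    have : Real.log 5 ≤ Real.log N := Real.log_le_log (by norm_num) hN5
    linarith
  refine le_trans ?_ (key (1.732 * N) (3 * (N : ℝ) ^ 2) (1.0986 + 2 * Real.log N) (by positivity)
    (by nlinarith) (by positivity) hyN (by linarith) (by linarith))
  have h4 : Real.log (2 ^ 2) ≤ Real.log (1.0986 + 2 * Real.log N) :=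
    Real.log_le_log (by norm_num) (by linarith)
  rw [Real.log_pow] at h4
  norm_num at h4
  have hQ := QS_bound N h
  have : QS N ≤ 1.732 * (0.2098 * (1.0986 + 2 * Real.log N) +
      0.1013 * Real.log (1.0986 + 2 * Real.log N) + 0.3183) := by linarith
  calc (N : ℝ) * QS N ≤ N * (1.732 * (0.2098 * (1.0986 + 2 * Real.log N) +
      0.1013 * Real.log (1.0986 + 2 * Real.log N) + 0.3183)) := by gcongr
    _ = _ := by ring

end Helpers


/-- Upper bound on the class number: for a prime `p` and a negative fundamental discriminant
`d` with `3 ≤ |d| ≤ 4p`, the class number `h(d)` of the imaginary quadratic field of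
discriminant `d` satisfies
`h(d) ≤ ((1+π)/π²) √p ln(4p) + (2/π²) √p ln ln(4p) + (2/π) √p`. -/
theorem stmt_8 (p : ℕ) (hp : p.Prime) (d : ℤ) (hd : d < 0)
    (K : Type) [Field K] [NumberField K]
    (hrank : Module.finrank ℚ K = 2) (hdisc : NumberField.discr K = d)
    (hd3 : 3 ≤ |d|) (hd4p : |d| ≤ 4 * p) :
    (NumberField.classNumber K : ℝ) ≤
      (1 + Real.pi) / Real.pi ^ 2 * Real.sqrt p * Real.log (4 * p)
        + 2 / Real.pi ^ 2 * Real.sqrt p * Real.log (Real.log (4 * p))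
        + 2 / Real.pi * Real.sqrt p := by
  obtain ⟨w, t, n, hw, htn, hspan, hli, hN⟩ := quad_basis K hrank
  rw [hdisc] at htn
  rw [abs_of_neg hd] at hd3 hd4p
  obtain ⟨D, hD⟩ : ∃ D : ℕ, (D : ℤ) = -d := ⟨(-d).toNat, by omega⟩
  obtain ⟨N, hNdef⟩ : ∃ N, N = Nat.sqrt (D / 3) := ⟨_, rfl⟩
  have hN1 : 1 ≤ N := by
    rw [hNdef, Nat.le_sqrt]; omega
  have hN2 : 3 * N ^ 2 ≤ D := by
    have := Nat.sqrt_le' (D / 3)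
    rw [← hNdef] at this
    omega
  have hN3 : D < 3 * (N + 1) ^ 2 := by
    have := Nat.lt_succ_sqrt' (D / 3)
    rw [← hNdef, Nat.succ_eq_add_one] at this
    omega
  have hcount := class_count K w t n hw hspan hli hN (by omega) N (by
    have : (D : ℤ) < 3 * ((N : ℤ) + 1) ^ 2 := by exact_mod_cast hN3
    linarith)
  have hroot := qroot_le t n (fun q hq x h1 h2 => quad_max K w t n hw hspan hli q hq x h1 h2)
  have h1 : NumberField.classNumber K ≤ ∑ a ∈ Finset.Icc 1 N, 2 ^ a.primeFactors.card :=
    hcount.trans (Finset.sum_le_sum fun a ha => hroot a (Finset.mem_Icc.1 ha).1)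
  have h2 : (NumberField.classNumber K : ℝ) ≤ N * QS N := by
    rw [← QS_eq]
    exact (Nat.cast_le.2 h1).trans (sum_two_pow_le N)
  have hp2 : (2 : ℝ) ≤ p := by exact_mod_cast hp.two_le
  have hDp : D ≤ 4 * p := by omega
  have h3 := final_bound N hN1 (4 * p) (by linarith) (by exact_mod_cast hN2.trans hDp)
  refine h2.trans (h3.trans ?_)
  have hsq : Real.sqrt (4 * p) = 2 * Real.sqrt p := by
    rw [Real.sqrt_mul (by norm_num), show (4 : ℝ) = 2 ^ 2 by norm_num,
      Real.sqrt_sq (by norm_num)]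
  rw [hsq]
  have hlog : 1 ≤ Real.log (4 * p) := by
    have h8 : Real.log 8 = 3 * Real.log 2 := by
      rw [show (8 : ℝ) = 2 ^ 3 by norm_num, Real.log_pow]
      norm_num
    have := Real.log_two_gt_d9
    have : Real.log 8 ≤ Real.log (4 * p) := Real.log_le_log (by norm_num) (by linarith)
    linarith
  have hloglog : 0 ≤ Real.log (Real.log (4 * p)) := Real.log_nonneg hlog
  have hpi1 := Real.pi_gt_d6
  have hpi2 := Real.pi_lt_d6
  have hpipos := Real.pi_pos
  have c1 : 0.4196 ≤ (1 + Real.pi) / Real.pi ^ 2 := by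
    rw [le_div_iff₀ (by positivity)]; nlinarith
  have c2 : 0.2026 ≤ 2 / Real.pi ^ 2 := by
    rw [le_div_iff₀ (by positivity)]; nlinarith
  have c3 : 0.6366 ≤ 2 / Real.pi := by
    rw [le_div_iff₀ (by positivity)]; nlinarith
  calc 2 * Real.sqrt p * (0.2098 * Real.log (4 * p) + 0.1013 * Real.log (Real.log (4 * p)) + 0.3183)
      = 0.4196 * Real.sqrt p * Real.log (4 * p)
        + 0.2026 * Real.sqrt p * Real.log (Real.log (4 * p)) + 0.6366 * Real.sqrt p := by ring
    _ ≤ _ := by gcongr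
end
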